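/- arXiv:2312.14351 — 6 statements merged into one kernel-verified Lean document; each statement's English description precedes it below -/
import Mathlib

section
/- For every integer n ≥ 8, the number of permutations π in S_n such that π avoids both of the patterns 213 and 312 and π² avoids the pattern 123 equals ⌊n/2⌋. -/
/-- A permutation `π` of `Fin n` contains the pattern `τ` (a permutation of `Fin m`)
if there is a strictly increasing choice of `m` indices on which `π` is
order-isomorphic to `τ`. -/
def PermContains {n m : ℕ} (π : Equiv.Perm (Fin n)) (τ : Equiv.Perm (Fin m)) : Prop :=
  ∃ f : Fin m → Fin n, StrictMono f ∧ ∀ i j : Fin m, τ i < τ j ↔ π (f i) < π (f j)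

/-- `π` avoids the pattern `τ`. -/
def PermAvoids {n m : ℕ} (π : Equiv.Perm (Fin n)) (τ : Equiv.Perm (Fin m)) : Prop :=
  ¬ PermContains π τ

/-- The pattern 123 (one-line notation), as a permutation of `Fin 3`. -/
def p123 : Equiv.Perm (Fin 3) := ⟨![0,1,2], ![0,1,2], by decide, by decide⟩
/-- The pattern 132. -/
def p132 : Equiv.Perm (Fin 3) := ⟨![0,2,1], ![0,2,1], by decide, by decide⟩
/-- The pattern 213. -/
def p213 : Equiv.Perm (Fin 3) := ⟨![1,0,2], ![1,0,2], by decide, by decide⟩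
/-- The pattern 231. -/
def p231 : Equiv.Perm (Fin 3) := ⟨![1,2,0], ![2,0,1], by decide, by decide⟩
/-- The pattern 312. -/
def p312 : Equiv.Perm (Fin 3) := ⟨![2,0,1], ![1,2,0], by decide, by decide⟩
/-- The pattern 321. -/
def p321 : Equiv.Perm (Fin 3) := ⟨![2,1,0], ![2,1,0], by decide, by decide⟩

theorem permContains_p213_iff {n : ℕ} (π : Equiv.Perm (Fin n)) :
    PermContains π p213 ↔ ∃ i j l, i < j ∧ j < l ∧ π j < π i ∧ π i < π l := by
  constructor
  · rintro ⟨f, hf, h⟩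
    exact ⟨f 0, f 1, f 2, hf (by decide), hf (by decide), (h 1 0).1 (by decide),
      (h 0 2).1 (by decide)⟩
  · rintro ⟨i, j, l, hij, hjl, h₁, h₂⟩
    refine ⟨![i, j, l], ?_, ?_⟩
    · intro x y hxy
      fin_cases x <;> fin_cases y <;> simp at hxy ⊢ <;> order
    · intro x y
      fin_cases x <;> fin_cases y <;> simp [p213] <;> order

theorem permContains_p312_iff {n : ℕ} (π : Equiv.Perm (Fin n)) :
    PermContains π p312 ↔ ∃ i j l, i < j ∧ j < l ∧ π j < π l ∧ π l < π i := by
  constructor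
  · rintro ⟨f, hf, h⟩
    exact ⟨f 0, f 1, f 2, hf (by decide), hf (by decide), (h 1 2).1 (by decide),
      (h 2 0).1 (by decide)⟩
  · rintro ⟨i, j, l, hij, hjl, h₁, h₂⟩
    refine ⟨![i, j, l], ?_, ?_⟩
    · intro x y hxy
      fin_cases x <;> fin_cases y <;> simp at hxy ⊢ <;> order
    · intro x y
      fin_cases x <;> fin_cases y <;> simp [p312] <;> order

theorem permContains_p123_iff {n : ℕ} (π : Equiv.Perm (Fin n)) :
    PermContains π p123 ↔ ∃ i j l, i < j ∧ j < l ∧ π i < π j ∧ π j < π l := by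
  constructor
  · rintro ⟨f, hf, h⟩
    exact ⟨f 0, f 1, f 2, hf (by decide), hf (by decide), (h 0 1).1 (by decide),
      (h 1 2).1 (by decide)⟩
  · rintro ⟨i, j, l, hij, hjl, h₁, h₂⟩
    refine ⟨![i, j, l], ?_, ?_⟩
    · intro x y hxy
      fin_cases x <;> fin_cases y <;> simp at hxy ⊢ <;> order
    · intro x y
      fin_cases x <;> fin_cases y <;> simp [p123] <;> order

/-- A permutation avoiding 213 and 312 increases up to the position of its maximum and
decreases afterwards. -/
theorem exists_peak {n : ℕ} {π : Equiv.Perm (Fin n)} (hn : 0 < n)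
    (h213 : PermAvoids π p213) (h312 : PermAvoids π p312) :
    ∃ k : Fin n, (π k : ℕ) = n - 1 ∧ StrictMonoOn π (Set.Iic k) ∧ StrictAntiOn π (Set.Ici k) := by
  rw [PermAvoids, permContains_p213_iff] at h213
  rw [PermAvoids, permContains_p312_iff] at h312
  push Not at h213 h312
  obtain ⟨k, hk⟩ := π.surjective ⟨n - 1, by omega⟩
  have hmax : ∀ i, i ≠ k → π i < π k := fun i hi => by
    have h₁ : π i ≠ π k := π.injective.ne hi
    rw [Ne, Fin.ext_iff] at h₁
    rw [Fin.lt_def]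
    rw [hk] at h₁ ⊢
    have := (π i).isLt
    simp only at h₁ ⊢
    omega
  refine ⟨k, by rw [hk], ?_, ?_⟩
  · intro i _ j hj hij
    rcases (Set.mem_Iic.1 hj).eq_or_lt with rfl | hjk
    · exact hmax i hij.ne
    · by_contra hlt
      have hne : π i ≠ π j := π.injective.ne hij.ne
      exact absurd (h213 i j k hij hjk (by order)) (hmax i (hij.trans hjk).ne).not_ge
  · intro i hi j _ hij
    rcases (Set.mem_Ici.1 hi).eq_or_lt with rfl | hki
    · exact hmax j hij.ne'
    · by_contra hlt
      have hne : π i ≠ π j := π.injective.ne hij.ne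
      exact absurd (h312 k i j hki hij (by order)) (hmax j (hki.trans hij).ne').not_ge

theorem permAvoids_p213_of_peak {n : ℕ} {π : Equiv.Perm (Fin n)} {k : Fin n}
    (hmono : StrictMonoOn π (Set.Iic k)) (hanti : StrictAntiOn π (Set.Ici k)) :
    PermAvoids π p213 := by
  rw [PermAvoids, permContains_p213_iff]
  rintro ⟨i, j, l, hij, hjl, h₁, h₂⟩
  rcases le_total j k with h | h
  · exact (hmono (hij.le.trans h) h hij).not_gt h₁
  · exact (hanti h (h.trans hjl.le) hjl).not_gt (h₁.trans h₂)

theorem permAvoids_p312_of_peak {n : ℕ} {π : Equiv.Perm (Fin n)} {k : Fin n}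
    (hmono : StrictMonoOn π (Set.Iic k)) (hanti : StrictAntiOn π (Set.Ici k)) :
    PermAvoids π p312 := by
  rw [PermAvoids, permContains_p312_iff]
  rintro ⟨i, j, l, hij, hjl, h₁, h₂⟩
  rcases le_total j k with h | h
  · exact (hmono (hij.le.trans h) h hij).not_gt (h₁.trans h₂)
  · exact (hanti h (h.trans hjl.le) hjl).not_gt h₁

theorem add_sub_le_of_increasing {f : ℕ → ℕ} {l r : ℕ}
    (hf : ∀ i j, l ≤ i → i < j → j ≤ r → f i < f j) {i j : ℕ} (hi : l ≤ i) (hij : i ≤ j)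
    (hj : j ≤ r) : f i + (j - i) ≤ f j := by
  induction j, hij using Nat.le_induction with
  | base => simp
  | succ j hij ih =>
    have := hf j (j + 1) (by omega) (by omega) hj
    have := ih (by omega)
    omega

theorem add_sub_le_of_decreasing {f : ℕ → ℕ} {l r : ℕ}
    (hf : ∀ i j, l ≤ i → i < j → j < r → f j < f i) {i j : ℕ} (hi : l ≤ i) (hij : i ≤ j)
    (hj : j < r) : f j + (j - i) ≤ f i := by
  induction j, hij using Nat.le_induction with
  | base => simp
  | succ j hij ih =>
    have := hf j (j + 1) (by omega) (by omega) hj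
    have := ih (by omega)
    omega

/-- The position of the maximum of the unimodal permutation of `{0, …, n - 1}` that starts with `a`
and whose square avoids 123. -/
def peak (n a : ℕ) : ℕ := if a < (n + 1) / 2 then n / 2 else n / 2 - 1

/-- A unimodal bijection of `{0, …, n - 1}` whose square avoids 123 starts with some `a` in
`[1, n / 2]`, and `a` determines its increasing part. -/
theorem increasing_part_of_sq_avoids {n k : ℕ} {P : ℕ → ℕ} (hn : 8 ≤ n) (hk : k < n)
    (hlt : ∀ i < n, P i < n) (hinj : ∀ i < n, ∀ j < n, P i = P j → i = j)
    (hsurj : ∀ v < n, ∃ i < n, P i = v) (hPk : P k = n - 1)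
    (hinc : ∀ i j, i < j → j ≤ k → P i < P j)
    (hdec : ∀ i j, k ≤ i → i < j → j < n → P j < P i)
    (hav : ∀ x y z, x < y → y < z → z < n → P (P x) < P (P y) → P (P z) ≤ P (P y)) :
    1 ≤ P 0 ∧ P 0 ≤ n / 2 ∧ k = peak n (P 0) ∧
      ∀ i, 1 ≤ i → i ≤ k → P i = n - 1 + i - k := by
  have gapI : ∀ i j, i ≤ j → j ≤ k → P i + (j - i) ≤ P j := fun i j hij hj =>
    add_sub_le_of_increasing (l := 0) (fun i j _ => hinc i j) (Nat.zero_le i) hij hj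
  have gapD : ∀ i j, k ≤ i → i ≤ j → j < n → P j + (j - i) ≤ P i := fun i j =>
    add_sub_le_of_decreasing hdec
  have hqinj : ∀ i < n, ∀ j < n, P (P i) = P (P j) → i = j := fun i hi j hj h =>
    hinj i hi j hj (hinj _ (hlt i hi) _ (hlt j hj) h)
  have hqlt : ∀ i < n, P (P i) < n := fun i hi => hlt _ (hlt i hi)
  have qdec : ∀ x < n, P (P x) = 0 → ∀ i j, x + 1 ≤ i → i < j → j < n → P (P j) < P (P i) := by
    intro x hx hx0 i j hi hij hj
    have h₁ : P (P i) ≠ P (P x) := fun h => by have := hqinj _ (by omega) _ hx h; omega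
    have h₂ : P (P i) ≠ P (P j) := fun h => by have := hqinj _ (by omega) _ hj h; omega
    have := hav x i j (by omega) hij hj (by omega)
    omega
  have ha : 1 ≤ P 0 := by
    by_contra hcon
    have ha : P 0 = 0 := by omega
    have gapQ : ∀ i j, 1 ≤ i → i ≤ j → j < n → P (P j) + (j - i) ≤ P (P i) := fun i j =>
      add_sub_le_of_decreasing (qdec 0 (by omega) (by rw [ha, ha]))
    have hpos : P (P (n - 1)) ≠ P (P 0) := fun h => by
      have := hqinj _ (by omega) _ (by omega) h; omega
    rw [ha, ha] at hpos
    have h₁ := gapQ 1 (n - 1) le_rfl (by omega) (by omega)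
    have h₂ := hqlt 1 (by omega)
    obtain ⟨i, hi, hPi⟩ := hsurj 1 (by omega)
    have hi0 : i ≠ 0 := by rintro rfl; omega
    rcases le_or_gt i k with hik | hik
    · rcases (show i = 1 ∨ 1 < i by omega) with rfl | h
      · rw [hPi, hPi] at h₁ h₂; omega
      · have := hinc 0 1 (by omega) (by omega); have := hinc 1 i h hik; omega
    · rcases (show i = n - 1 ∨ i < n - 1 by omega) with rfl | h
      · rw [hPi] at h₁ hpos
        have := hinj 1 (by omega) (n - 1) (by omega) (by omega)
        omega
      · have := hdec i (n - 1) hik.le h (by omega)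
        have := hinj (n - 1) (by omega) 0 (by omega) (by omega)
        omega
  have hlast : P (n - 1) = 0 := by
    obtain ⟨i, hi, hPi⟩ := hsurj 0 (by omega)
    rcases le_or_gt i k with hik | hik
    · rcases (show i = 0 ∨ 0 < i by omega) with rfl | h
      · omega
      · have := hinc 0 i h hik; omega
    · rcases (show i = n - 1 ∨ i < n - 1 by omega) with rfl | h
      · exact hPi
      · have := hdec i (n - 1) hik.le h (by omega); omega
  have gapQ : ∀ i j, k + 1 ≤ i → i ≤ j → j < n → P (P j) + (j - i) ≤ P (P i) := fun i j =>
    add_sub_le_of_decreasing (qdec k hk (by rw [hPk, hlast]))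
  have hP2 : 2 ≤ k → k + 1 ≤ P 2 := by
    intro h2
    by_contra hcon
    have h01 := hinc 0 1 (by omega) (by omega)
    have h12 := hinc 1 2 (by omega) (by omega)
    have := hinc _ _ h12 (by omega)
    have := hav 0 1 2 (by omega) (by omega) (by omega) (hinc _ _ h01 (by omega))
    omega
  have h2k : 2 ≤ k → 2 * k ≤ n := by
    intro h
    have := hP2 h
    have := gapI 2 k h le_rfl
    omega
  have hkn : k + 2 < n := by by_contra; omega
  have hPk2 : P (k + 2) < k := by
    by_contra hcon
    have h₁ := hdec (k + 1) (k + 2) (by omega) (by omega) hkn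
    have h₂ := hdec (P (k + 2)) (P (k + 1)) (by omega) h₁ (hlt _ (by omega))
    have := gapQ (k + 1) (k + 2) le_rfl (by omega) hkn
    omega
  have hn2 := gapD (k + 2) (n - 1) (by omega) (by omega) (by omega)
  have htail : ∀ i, k + 2 ≤ i → i < n → P i < k := fun i hi hin => by
    have := gapD (k + 2) i (by omega) hi hin
    omega
  specialize hP2 (by omega)
  specialize h2k (by omega)
  have hP01 := hinc 0 1 (by omega) (by omega)
  have hP12 := hinc 1 2 (by omega) (by omega)
  have hP1 : P 1 ≤ k → P 1 = k := by
    intro h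
    have h01 := hinc _ _ hP01 h
    obtain ⟨j, hj, hPj⟩ := hsurj k hk
    have hqj : P (P j) = n - 1 := by rw [hPj, hPk]
    have := hqlt 1 (by omega)
    have : j = 1 := by
      by_contra hj1
      rcases (show j = 0 ∨ 1 < j by omega) with rfl | hj'
      · omega
      · have := hav 0 1 j (by omega) hj' hj h01
        have := hqinj j hj 1 (by omega) (by omega)
        omega
    rw [← this, hPj]
  -- A decreasing tail of consecutive values ending in `0` would repeat the value `P 0`.
  have hrep : ∀ s, k < s → s < n → P 0 ≤ n - 1 - s → n - 1 - s < P s := by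
    intro s hs hsn has
    by_contra hcon
    have h₁ := gapD s (n - 1 - P 0) (by omega) (by omega) (by omega)
    have h₂ := gapD (n - 1 - P 0) (n - 1) (by omega) (by omega) (by omega)
    have := hinj 0 (by omega) (n - 1 - P 0) (by omega) (by omega)
    omega
  refine ⟨ha, ?_⟩
  unfold peak
  rcases (show n = 2 * k ∨ n = 2 * k + 1 ∨ n = 2 * k + 2 by omega) with h | h | h
  · have hg2 := gapI 2 k (by omega) le_rfl
    have := hP1 (by omega)
    refine ⟨by omega, by rw [if_pos (by omega)]; omega, fun i hi hik => ?_⟩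
    have h₁ := gapI 1 i hi hik
    have h₂ := gapI i k hik le_rfl
    rcases (show i = 1 ∨ 2 ≤ i by omega) with rfl | hi2
    · omega
    · have := gapI 2 i hi2 hik
      omega
  · have hP1' : k + 1 ≤ P 1 := by
      by_contra hcon
      have hP1 := hP1 (by omega)
      have hc := hrep (k + 1) (by omega) (by omega) (by omega)
      have hck : P (k + 1) ≠ k := fun h => by
        have := hinj (k + 1) (by omega) 1 (by omega) (by omega); omega
      have hq := gapQ (k + 1) (n - 1) le_rfl (by omega) (by omega)
      rw [hlast] at hq
      rcases (show P (k + 1) = k + 1 ∨ k + 2 ≤ P (k + 1) by omega) with hc' | hc'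
      · have hP2' : P 2 ≠ k + 1 := fun h => by
          have := hinj 2 (by omega) (k + 1) (by omega) (by omega); omega
        have hbig : ∀ j < n, k + 2 ≤ P (P j) → P (P j) < n - 1 → j = 0 := by
          intro j hj hj₁ hj₂
          by_contra hj0
          rcases (show j = 1 ∨ (2 ≤ j ∧ j ≤ k) ∨ k + 1 ≤ j by omega) with rfl | hj' | hj'
          · rw [hP1] at hj₂; omega
          · have := gapI 2 j hj'.1 hj'.2
            have := htail (P j) (by omega) (hlt j hj)
            omega
          · have := gapQ (k + 1) j le_rfl hj' hj
            rw [hc', hc'] at this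
            omega
        obtain ⟨i₁, hi₁, hPi₁⟩ := hsurj (n - 2) (by omega)
        obtain ⟨j₁, hj₁, hPj₁⟩ := hsurj i₁ hi₁
        obtain ⟨i₂, hi₂, hPi₂⟩ := hsurj (n - 3) (by omega)
        obtain ⟨j₂, hj₂, hPj₂⟩ := hsurj i₂ hi₂
        have e₁ := hbig j₁ hj₁ (by rw [hPj₁]; omega) (by rw [hPj₁]; omega)
        have e₂ := hbig j₂ hj₂ (by rw [hPj₂]; omega) (by rw [hPj₂]; omega)
        subst e₁ e₂
        rw [← hPj₁] at hPi₁
        rw [← hPj₂] at hPi₂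
        omega
      · have := htail (P (k + 1)) hc' (hlt _ (by omega))
        omega
    have hg := gapI 1 k (by omega) le_rfl
    refine ⟨?_, ?_, fun i hi hik => ?_⟩
    · omega
    · rw [if_pos (by omega)]; omega
    · have h₁ := gapI 1 i hi hik
      have h₂ := gapI i k hik le_rfl
      omega
  · have ha' : k ≤ P 0 := by
      by_contra hcon
      have := hrep (k + 2) (by omega) (by omega) (by omega)
      omega
    have ha'' : P 0 ≠ k := by
      intro hak
      have hc := hrep (k + 1) (by omega) (by omega) (by omega)
      have hq := gapQ (k + 1) (n - 1) le_rfl (by omega) (by omega)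
      rw [hlast] at hq
      rcases (show P (k + 1) = k + 1 ∨ k + 2 ≤ P (k + 1) by omega) with hc' | hc'
      · rw [hc', hc'] at hq; omega
      · have := htail (P (k + 1)) hc' (hlt _ (by omega))
        omega
    have hg := gapI 0 k (by omega) le_rfl
    refine ⟨by omega, by rw [if_neg (by omega)]; omega, fun i hi hik => ?_⟩
    have h₁ := gapI 0 i (by omega) hik
    have h₂ := gapI i k hik le_rfl
    omega

/-- Two permutations that agree up to position `k` and decrease afterwards are equal. -/
theorem perm_eq_of_strictAntiOn_Ioi {n : ℕ} {π ρ : Equiv.Perm (Fin n)} {k : Fin n}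
    (heq : ∀ i ≤ k, π i = ρ i) (hπ : StrictAntiOn π (Set.Ioi k))
    (hρ : StrictAntiOn ρ (Set.Ioi k)) : π = ρ := by
  have hfix : ∀ i ≤ k, (ρ⁻¹ * π) i = i := fun i hi => by
    simp [Equiv.Perm.mul_apply, heq i hi]
  have hgt : ∀ i, k < i → k < (ρ⁻¹ * π) i := fun i hi => by
    by_contra h
    exact absurd ((ρ⁻¹ * π).injective (hfix _ (not_lt.1 h))) (by order)
  have hmono : StrictMono (ρ⁻¹ * π) := by
    intro i j hij
    rcases le_or_gt j k with hj | hj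
    · rwa [hfix i (hij.le.trans hj), hfix j hj]
    rcases le_or_gt i k with hi | hi
    · rw [hfix i hi]
      exact hi.trans_lt (hgt j hj)
    · rw [← hρ.lt_iff_gt (hgt j hj) (hgt i hi)]
      simpa [Equiv.Perm.mul_apply] using hπ hi hj hij
  have h := (hmono.range_inj strictMono_id).1
    (by rw [(ρ⁻¹ * π).surjective.range_eq, Set.range_id])
  have h1 : ρ⁻¹ * π = 1 := Equiv.ext fun i => congrFun h i
  exact (inv_mul_eq_one.1 h1).symm

/-- The values of the unimodal permutation of `{0, …, n - 1}` that starts with `a`, has its maximum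
at `peak n a`, and takes the largest values at positions `1, …, peak n a`. -/
def bell (n a i : ℕ) : ℕ :=
  if i = 0 then a else if i ≤ peak n a then n - 1 + i - peak n a
  else if n - 1 - i < a then n - 1 - i else n - i

section bell

variable {n a : ℕ}

theorem peak_add_half (hn : 2 ≤ n) (ha : a ≤ n / 2) :
    (a < (n + 1) / 2 ∧ peak n a = n / 2) ∨
      (n = 2 * a ∧ peak n a + 1 = a) := by
  unfold peak
  split_ifs <;> omega

theorem bell_lt (hn : 2 ≤ n) (ha : a ≤ n / 2) {i : ℕ} (hi : i < n) : bell n a i < n := by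
  have := peak_add_half hn ha
  unfold bell
  split_ifs <;> omega

theorem bell_injOn (hn : 2 ≤ n) (ha : a ≤ n / 2) {i j : ℕ} (hi : i < n) (hj : j < n)
    (h : bell n a i = bell n a j) : i = j := by
  have := peak_add_half hn ha
  unfold bell at h
  split_ifs at h <;> omega

theorem bell_increasing (hn : 2 ≤ n) (ha : a ≤ n / 2) {i j : ℕ} (hij : i < j)
    (hj : j ≤ peak n a) : bell n a i < bell n a j := by
  have := peak_add_half hn ha
  unfold bell
  split_ifs <;> omega

theorem bell_decreasing (hn : 4 ≤ n) (ha : a ≤ n / 2) {i j : ℕ} (hi : peak n a ≤ i)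
    (hij : i < j) (hj : j < n) : bell n a j < bell n a i := by
  have := peak_add_half (by omega) ha
  unfold bell
  split_ifs <;> omega

theorem bell_sq_avoids (hn : 4 ≤ n) (ha₁ : 1 ≤ a) (ha : a ≤ n / 2) {x y z : ℕ} (hxy : x < y)
    (hyz : y < z) (hz : z < n) (h : bell n a (bell n a x) < bell n a (bell n a y)) :
    bell n a (bell n a z) ≤ bell n a (bell n a y) := by
  have hp := peak_add_half (by omega) ha
  have rise : ∀ i, 1 ≤ i → i ≤ peak n a → bell n a i = n - 1 + i - peak n a := fun i h₁ h₂ => by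
    unfold bell
    split_ifs <;> omega
  have tail : ∀ i, peak n a < i → i < n → bell n a i < (n + 1) / 2 := fun i h₁ h₂ => by
    unfold bell
    split_ifs <;> omega
  have antiL : ∀ i j, 1 ≤ i → i < j → j ≤ peak n a →
      bell n a (bell n a j) < bell n a (bell n a i) := fun i j hi hij hj => by
    have h₁ := rise i hi (by omega)
    have h₂ := rise j (by omega) hj
    exact bell_decreasing hn ha (by omega) (by omega) (by omega)
  have antiR : ∀ i j, peak n a < i → i < j → j < n →
      bell n a (bell n a j) < bell n a (bell n a i) := fun i j hi hij hj => by
    have h₁ := tail i hi (by omega)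
    exact bell_increasing (by omega) ha (bell_decreasing hn ha hi.le hij hj) (by omega)
  by_contra! hcon
  have hy : y ≤ peak n a := by
    by_contra hy
    have := antiR y z (by omega) hyz hz
    omega
  have hx : x = 0 := by
    by_contra hx
    have := antiL x y (by omega) hxy hy
    omega
  subst hx
  have h0 : bell n a 0 = a := by simp [bell]
  have hy' := rise y hxy hy
  have hzlt := bell_lt (by omega) ha (bell_lt (by omega) ha hz)
  rw [h0] at h
  rcases hp with ⟨ha', hp⟩ | ⟨hna, hp⟩
  · have h₁ := rise a ha₁ (by omega)
    rcases (show bell n a y = peak n a ∨ peak n a < bell n a y by omega) with he | hlt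
    · rw [he, rise (peak n a) (by omega) le_rfl] at hcon
      omega
    · have := tail _ hlt (by omega)
      omega
  · have := bell_decreasing hn ha (i := a) (j := bell n a y) (by omega) (by omega) (by omega)
    omega

/-- `bell n a` as a permutation of `Fin n`. -/
noncomputable def bellPerm (hn : 2 ≤ n) (ha : a ≤ n / 2) : Equiv.Perm (Fin n) :=
  Equiv.ofBijective (fun i => ⟨bell n a i, bell_lt hn ha i.isLt⟩)
    (Finite.injective_iff_bijective.1 fun i j h =>
      Fin.ext (bell_injOn hn ha i.isLt j.isLt (Fin.ext_iff.1 h)))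

@[simp]
theorem bellPerm_apply (hn : 2 ≤ n) (ha : a ≤ n / 2) (i : Fin n) :
    (bellPerm hn ha i : ℕ) = bell n a i := rfl

theorem bellPerm_avoids (hn : 4 ≤ n) (ha₁ : 1 ≤ a) (ha : a ≤ n / 2) :
    PermAvoids (bellPerm (by omega) ha) p213 ∧ PermAvoids (bellPerm (by omega) ha) p312 ∧
      PermAvoids (bellPerm (by omega) ha ^ 2) p123 := by
  have hp := peak_add_half (by omega) ha
  have hmono : StrictMonoOn (bellPerm (by omega) ha) (Set.Iic ⟨peak n a, by omega⟩) :=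
    fun i _ j hj hij => bell_increasing (by omega) ha hij hj
  have hanti : StrictAntiOn (bellPerm (by omega) ha) (Set.Ici ⟨peak n a, by omega⟩) :=
    fun i hi j _ hij => bell_decreasing hn ha hi hij j.isLt
  refine ⟨permAvoids_p213_of_peak hmono hanti, permAvoids_p312_of_peak hmono hanti, ?_⟩
  rw [PermAvoids, permContains_p123_iff]
  rintro ⟨x, y, z, hxy, hyz, h₁, h₂⟩
  simp only [sq, Equiv.Perm.mul_apply, Fin.lt_def, bellPerm_apply] at h₁ h₂
  exact (bell_sq_avoids hn ha₁ ha hxy hyz z.isLt h₁).not_gt h₂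

end bell

theorem increasing_part_of_avoids {n : ℕ} [NeZero n] (hn : 8 ≤ n) {π : Equiv.Perm (Fin n)}
    (h213 : PermAvoids π p213) (h312 : PermAvoids π p312) (h123 : PermAvoids (π ^ 2) p123) :
    1 ≤ (π 0 : ℕ) ∧ (π 0 : ℕ) ≤ n / 2 ∧ ∃ k : Fin n, (k : ℕ) = peak n (π 0) ∧
      StrictAntiOn π (Set.Ici k) ∧
      ∀ i : Fin n, 1 ≤ (i : ℕ) → i ≤ k → (π i : ℕ) = n - 1 + i - k := by
  obtain ⟨k, hk, hmono, hanti⟩ := exists_peak (by omega) h213 h312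
  rw [PermAvoids, permContains_p123_iff] at h123
  push Not at h123
  let P : ℕ → ℕ := fun i => if h : i < n then π ⟨i, h⟩ else 0
  have hP : ∀ i : Fin n, P i = π i := fun i => by simp [P]
  have hP' : ∀ i (h : i < n), P i = π ⟨i, h⟩ := fun i h => hP ⟨i, h⟩
  obtain ⟨h₁, h₂, h₃, h₄⟩ := increasing_part_of_sq_avoids (P := P) hn k.isLt
    (fun i hi => by rw [hP' i hi]; exact Fin.isLt _)
    (fun i hi j hj h => by
      rw [hP' i hi, hP' j hj, ← Fin.ext_iff] at h
      exact Fin.ext_iff.1 (π.injective h))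
    (fun v hv => by
      obtain ⟨i, hi⟩ := π.surjective ⟨v, hv⟩
      exact ⟨i, i.isLt, by rw [hP, hi]⟩)
    (by rw [hP, hk])
    (fun i j hij hj => by
      have hj' := hj.trans_lt k.isLt
      rw [hP' i (hij.trans hj'), hP' j hj']
      exact hmono (a := ⟨i, _⟩) (b := ⟨j, _⟩) (hij.le.trans hj) hj hij)
    (fun i j hi hij hj => by
      rw [hP' i (hij.trans hj), hP' j hj]
      exact hanti (a := ⟨i, _⟩) (b := ⟨j, _⟩) hi (hi.trans hij.le) hij)
    (fun x y z hxy hyz hz h => by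
      have hy := hyz.trans hz
      rw [hP' x (hxy.trans hy), hP' y hy, hP, hP] at h
      rw [hP' z hz, hP' y hy, hP, hP]
      exact h123 ⟨x, _⟩ ⟨y, hy⟩ ⟨z, hz⟩ hxy hyz h)
  have h0 : P 0 = π 0 := hP 0
  rw [h0] at h₁ h₂ h₃
  exact ⟨h₁, h₂, k, h₃, hanti, fun i hi hik => by rw [← hP, h₄ i hi hik]⟩

theorem stmt0 (n : ℕ) (hn : 8 ≤ n) :
    Nat.card {π : Equiv.Perm (Fin n) //
      PermAvoids π p213 ∧ PermAvoids π p312 ∧ PermAvoids (π ^ 2) p123} = n / 2 := by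
  have : NeZero n := ⟨by omega⟩
  let φ : {π : Equiv.Perm (Fin n) //
      PermAvoids π p213 ∧ PermAvoids π p312 ∧ PermAvoids (π ^ 2) p123} →
      Finset.Icc 1 (n / 2) := fun π => ⟨π.1 0, Finset.mem_Icc.2 <| by
    obtain ⟨h₁, h₂, -⟩ := increasing_part_of_avoids hn π.2.1 π.2.2.1 π.2.2.2
    exact ⟨h₁, h₂⟩⟩
  have hφ : Function.Bijective φ := by
    constructor
    · rintro ⟨π, hπ⟩ ⟨ρ, hρ⟩ h
      have h0 : (π 0 : ℕ) = ρ 0 := congrArg Subtype.val h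
      obtain ⟨-, -, k, hk, hπanti, hπval⟩ := increasing_part_of_avoids hn hπ.1 hπ.2.1 hπ.2.2
      obtain ⟨-, -, l, hl, hρanti, hρval⟩ := increasing_part_of_avoids hn hρ.1 hρ.2.1 hρ.2.2
      obtain rfl : k = l := Fin.ext (by rw [hk, hl, h0])
      refine Subtype.ext (perm_eq_of_strictAntiOn_Ioi (k := k) (fun i hi => Fin.ext ?_)
        (hπanti.mono Set.Ioi_subset_Ici_self) (hρanti.mono Set.Ioi_subset_Ici_self))
      by_cases hi0 : i = 0
      · rw [hi0, h0]
      · have : (i : ℕ) ≠ 0 := fun h => hi0 (Fin.ext h)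
        rw [hπval i (by omega) hi, hρval i (by omega) hi]
    · rintro ⟨a, ha⟩
      obtain ⟨ha₁, ha₂⟩ := Finset.mem_Icc.1 ha
      exact ⟨⟨bellPerm (by omega) ha₂, bellPerm_avoids (by omega) ha₁ ha₂⟩,
        Subtype.ext (by simp [φ, bell])⟩
  rw [Nat.card_eq_of_bijective φ hφ, Nat.card_eq_fintype_card, Fintype.card_coe, Nat.card_Icc,
    Nat.add_sub_cancel]
end

section
/- For every integer n ≥ 1, the number of permutations π in S_n such that π avoids both of the patterns 213 and 312 and π² avoids the pattern 213 equals ⌈n(n+1)/3⌉. -/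
/-- Avoiding `213`, spelled out on positions. -/
theorem permAvoids_p213_iff {n : ℕ} (π : Equiv.Perm (Fin n)) :
    PermAvoids π p213 ↔ ∀ x y z : Fin n, x < y → y < z → ¬ (π y < π x ∧ π x < π z) := by
  unfold PermAvoids PermContains
  constructor
  · rintro h x y z hxy hyz ⟨h1, h2⟩
    refine h ⟨![x, y, z], ?_, ?_⟩
    · rw [Fin.strictMono_iff_lt_succ]
      intro i
      fin_cases i
      · exact hxy
      · exact hyz
    · intro i j
      have := h1.trans h2
      fin_cases i <;> fin_cases j <;> simp [p213] <;> order
  · rintro h ⟨f, hf, hp⟩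
    exact h (f 0) (f 1) (f 2) (hf (by decide)) (hf (by decide))
      ⟨(hp 1 0).1 (by decide), (hp 0 2).1 (by decide)⟩

/-- Avoiding `312`, spelled out on positions. -/
theorem permAvoids_p312_iff {n : ℕ} (π : Equiv.Perm (Fin n)) :
    PermAvoids π p312 ↔ ∀ x y z : Fin n, x < y → y < z → ¬ (π y < π z ∧ π z < π x) := by
  unfold PermAvoids PermContains
  constructor
  · rintro h x y z hxy hyz ⟨h1, h2⟩
    refine h ⟨![x, y, z], ?_, ?_⟩
    · rw [Fin.strictMono_iff_lt_succ]
      intro i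
      fin_cases i
      · exact hxy
      · exact hyz
    · intro i j
      have := h1.trans h2
      fin_cases i <;> fin_cases j <;> simp [p312] <;> order
  · rintro h ⟨f, hf, hp⟩
    exact h (f 0) (f 1) (f 2) (hf (by decide)) (hf (by decide))
      ⟨(hp 1 2).1 (by decide), (hp 2 0).1 (by decide)⟩

/-- `π` has no valley exactly when it avoids both `213` and `312`. -/
theorem permAvoids_p213_and_p312_iff {n : ℕ} (π : Equiv.Perm (Fin n)) :
    (PermAvoids π p213 ∧ PermAvoids π p312) ↔
      ∀ x y z : Fin n, x < y → y < z → ¬ (π y < π x ∧ π y < π z) := by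
  rw [permAvoids_p213_iff, permAvoids_p312_iff]
  constructor
  · rintro ⟨h1, h2⟩ x y z hxy hyz ⟨h3, h4⟩
    rcases lt_trichotomy (π x) (π z) with h | h | h
    · exact h1 x y z hxy hyz ⟨h3, h⟩
    · exact (hxy.trans hyz).ne (π.injective h)
    · exact h2 x y z hxy hyz ⟨h4, h⟩
  · intro h
    exact ⟨fun x y z hxy hyz h' => h x y z hxy hyz ⟨h'.1, h'.1.trans h'.2⟩,
      fun x y z hxy hyz h' => h x y z hxy hyz ⟨h'.1.trans h'.2, h'.1⟩⟩

/-- The map whose one-line notation is `0, …, f - 1`, then the `l` values from `f + k` upwards,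
then the `d` largest values in decreasing order, then `f + k - 1, …, f`. -/
def blockMap (f k l d i : ℕ) : ℕ :=
  if i < f then i
  else if i < f + l then i + k
  else if i < f + l + d then (f + l + d + k - 1) + (f + l) - i
  else (f + l + d + k - 1) + f - i

theorem blockMap_cases (f k l d i : ℕ) (hi : i < f + l + d + k) :
    (i < f ∧ blockMap f k l d i = i) ∨
    (f ≤ i ∧ i < f + l ∧ blockMap f k l d i = i + k) ∨
    (f + l ≤ i ∧ i < f + l + d ∧ blockMap f k l d i + i + 1 = f + l + d + k + f + l) ∨
    (f + l + d ≤ i ∧ blockMap f k l d i + i + 1 = f + l + d + k + f) := by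
  unfold blockMap
  split_ifs <;> omega

theorem blockMap_lt (f k l d i : ℕ) (hi : i < f + l + d + k) :
    blockMap f k l d i < f + l + d + k := by
  rcases blockMap_cases f k l d i hi with h | h | h | h <;> omega

theorem blockMap_inj (f k l d i j : ℕ) (hi : i < f + l + d + k) (hj : j < f + l + d + k)
    (h : blockMap f k l d i = blockMap f k l d j) : i = j := by
  rcases blockMap_cases f k l d i hi with hi | hi | hi | hi <;>
  rcases blockMap_cases f k l d j hj with hj | hj | hj | hj <;> omega

theorem blockMap_no_valley (f k l d x y z : ℕ) (hxy : x < y) (hyz : y < z)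
    (hz : z < f + l + d + k) :
    ¬ (blockMap f k l d y < blockMap f k l d x ∧ blockMap f k l d y < blockMap f k l d z) := by
  rintro ⟨h1, h2⟩
  rcases blockMap_cases f k l d x (by omega) with hx | hx | hx | hx <;>
  rcases blockMap_cases f k l d y (by omega) with hy | hy | hy | hy <;>
  first
  | omega
  | (rcases blockMap_cases f k l d z hz with hz | hz | hz | hz <;> omega)

/-- The square of `blockMap` when its increasing block is the shorter one. -/
theorem blockMap_blockMap_of_left (f k d i : ℕ) (hd : k ≤ d) (hi : i < f + k + d + k) :
    (i < f ∧ blockMap f k k d (blockMap f k k d i) = i) ∨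
    (f ≤ i ∧ i < f + k ∧ blockMap f k k d (blockMap f k k d i) + i + 1 = f + k + d + k + f) ∨
    (f + k ≤ i ∧ i < f + k + k ∧ blockMap f k k d (blockMap f k k d i) + k = i) ∨
    (f + k + k ≤ i ∧ i < f + k + d ∧ blockMap f k k d (blockMap f k k d i) = i) ∨
    (f + k + d ≤ i ∧ blockMap f k k d (blockMap f k k d i) + i + 1 =
      f + k + d + k + f + k) := by
  have h2 := blockMap_cases f k k d (blockMap f k k d i) (blockMap_lt f k k d i hi)
  rcases blockMap_cases f k k d i hi with h | h | h | h <;>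
  rcases h2 with h2 | h2 | h2 | h2 <;> omega

/-- The square of `blockMap` when its decreasing block is the shorter one. -/
theorem blockMap_blockMap_of_right (f k l i : ℕ) (hl : k ≤ l) (hi : i < f + l + k + k) :
    (i < f ∧ blockMap f k l k (blockMap f k l k i) = i) ∨
    (f ≤ i ∧ i + k < f + l ∧ blockMap f k l k (blockMap f k l k i) = i + k + k) ∨
    (f + l ≤ i + k ∧ i < f + l ∧ blockMap f k l k (blockMap f k l k i) + i + k + 1 =
      f + l + k + k + f + l) ∨
    (f + l ≤ i ∧ i < f + l + k ∧ blockMap f k l k (blockMap f k l k i) + l = i) ∨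
    (f + l + k ≤ i ∧ blockMap f k l k (blockMap f k l k i) + i + 1 =
      f + l + k + k + f + k) := by
  have h2 := blockMap_cases f k l k (blockMap f k l k i) (blockMap_lt f k l k i hi)
  rcases blockMap_cases f k l k i hi with h | h | h | h <;>
  rcases h2 with h2 | h2 | h2 | h2 <;> omega

theorem blockMap_sq_avoids (f l d x y z : ℕ) (hxy : x < y) (hyz : y < z)
    (hz : z < f + l + d + min l d) :
    ¬ (blockMap f (min l d) l d (blockMap f (min l d) l d y) <
        blockMap f (min l d) l d (blockMap f (min l d) l d x) ∧
      blockMap f (min l d) l d (blockMap f (min l d) l d x) <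
        blockMap f (min l d) l d (blockMap f (min l d) l d z)) := by
  rintro ⟨h1, h2⟩
  rcases le_total l d with h | h
  · rw [min_eq_left h] at *
    rcases blockMap_blockMap_of_left f l d x h (by omega) with hx | hx | hx | hx | hx <;>
    rcases blockMap_blockMap_of_left f l d y h (by omega) with hy | hy | hy | hy | hy <;>
    first
    | omega
    | (rcases blockMap_blockMap_of_left f l d z h hz with hz | hz | hz | hz | hz <;> omega)
  · rw [min_eq_right h] at *
    rcases blockMap_blockMap_of_right f d l x h (by omega) with hx | hx | hx | hx | hx <;>
    rcases blockMap_blockMap_of_right f d l y h (by omega) with hy | hy | hy | hy | hy <;>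
    first
    | omega
    | (rcases blockMap_blockMap_of_right f d l z h hz with hz | hz | hz | hz | hz <;> omega)

/-- If the square of `blockMap` avoids `213` then its tail is as long as the shorter
of the two other moved blocks. -/
theorem eq_min_of_blockMap_sq_avoids (f k l d : ℕ) (hk : 1 ≤ k) (hl : 1 ≤ l) (hd : 1 ≤ d)
    (h : ∀ x y z, x < y → y < z → z < f + l + d + k →
      ¬ (blockMap f k l d (blockMap f k l d y) < blockMap f k l d (blockMap f k l d x) ∧
        blockMap f k l d (blockMap f k l d x) < blockMap f k l d (blockMap f k l d z))) :
    k = min l d := by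
  have inc : ∀ i, f ≤ i → i < f + l → blockMap f k l d i = i + k := by
    intro i _ _
    have := blockMap_cases f k l d i (by omega)
    omega
  have dec : ∀ i, f + l ≤ i → i < f + l + d →
      blockMap f k l d i = f + l + d + k + f + l - 1 - i := by
    intro i _ _
    have := blockMap_cases f k l d i (by omega)
    omega
  have tail : ∀ i, f + l + d ≤ i → i < f + l + d + k →
      blockMap f k l d i = f + l + d + k + f - 1 - i := by
    intro i _ _
    have := blockMap_cases f k l d i (by omega)
    omega
  have hkd : k ≤ d := by
    by_contra! hlt
    apply h (f + l - 1) (f + l + d - 1) (f + l + d + k - 1) (by omega) (by omega) (by omega)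
    rw [inc (f + l - 1) (by omega) (by omega), dec (f + l + d - 1) (by omega) (by omega),
      tail (f + l + d + k - 1) (by omega) (by omega), tail (f + l - 1 + k) (by omega) (by omega),
      tail _ (by omega) (by omega), inc _ (by omega) (by omega)]
    omega
  have hkl : k ≤ l := by
    by_contra! hlt
    apply h f (f + l) (f + l + d + k - 1 - l) (by omega) (by omega) (by omega)
    have hf : blockMap f k l d (f + k) < f + l + d + k - 1 := by
      have := blockMap_cases f k l d (f + k) (by omega)
      omega
    have hf' : f < blockMap f k l d (f + k) := by
      have := blockMap_cases f k l d (f + k) (by omega)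
      omega
    rw [inc f (by omega) (by omega), dec (f + l) (by omega) (by omega),
      tail (f + l + d + k - 1 - l) (by omega) (by omega), tail _ (by omega) (by omega),
      dec (f + l + d + k + f - 1 - (f + l + d + k - 1 - l)) (by omega) (by omega)]
    omega
  by_contra hne
  apply h f (f + l) (f + l + d - 1) (by omega) (by omega) (by omega)
  rw [inc f (by omega) (by omega), dec (f + l) (by omega) (by omega),
    dec (f + l + d - 1) (by omega) (by omega), inc (f + k) (by omega) (by omega),
    tail _ (by omega) (by omega), dec _ (by omega) (by omega)]
  omega

/-- A valley-free permutation of `{0, …, n - 1}` whose square avoids `213` is a `blockMap`. -/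
theorem exists_eq_blockMap (n : ℕ) (hn : 1 ≤ n) (g : ℕ → ℕ) (hlt : ∀ i < n, g i < n)
    (hinj : ∀ i < n, ∀ j < n, g i = g j → i = j) (hsurj : ∀ v < n, ∃ i < n, g i = v)
    (hval : ∀ x y z, x < y → y < z → z < n → ¬ (g y < g x ∧ g y < g z))
    (hsq : ∀ x y z, x < y → y < z → z < n →
      ¬ (g (g y) < g (g x) ∧ g (g x) < g (g z))) :
    ∃ f l d, 1 ≤ d ∧ f + l + d + min l d = n ∧ ∀ i < n, g i = blockMap f (min l d) l d i := by
  obtain ⟨p, hpn, hp⟩ := hsurj (n - 1) (by omega)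
  have hle : ∀ i < n, i ≠ p → g i < n - 1 := by
    intro i hi hip
    have h1 := hlt i hi
    have h2 : g i ≠ n - 1 := fun h => hip (hinj i hi p hpn (h.trans hp.symm))
    omega
  have hmono : ∀ i j, i < j → j ≤ p → g i < g j := by
    intro i j hij hjp
    rcases hjp.eq_or_lt with rfl | hjp
    · rw [hp]
      exact hle i (by omega) (by omega)
    · by_contra! hc
      have h1 := hle j (by omega) (by omega)
      have h2 : g i ≠ g j := fun h => by have := hinj i (by omega) j (by omega) h; omega
      exact hval i j p hij hjp hpn (by omega)
  have hanti : ∀ i j, p ≤ i → i < j → j < n → g j < g i := by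
    intro i j hpi hij hj
    rcases hpi.eq_or_lt with rfl | hpi
    · rw [hp]
      exact hle j (by omega) (by omega)
    · by_contra! hc
      have h1 := hle i (by omega) (by omega)
      have h2 : g i ≠ g j := fun h => by have := hinj i (by omega) j (by omega) h; omega
      exact hval p i j hpi hij hj (by omega)
  obtain ⟨f, hf⟩ : ∃ f, g (n - 1) = f := ⟨_, rfl⟩
  have hfn : f < n := hf ▸ hlt _ (by omega)
  have hge : ∀ i, p ≤ i → i < n → f ≤ g i := by
    intro i hpi hi
    rcases (show i ≤ n - 1 by omega).eq_or_lt with rfl | h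
    · omega
    · have := hanti i (n - 1) hpi h (by omega)
      omega
  have hfix : ∀ i < f, g i = i := by
    intro i
    induction i using Nat.strong_induction_on with
    | _ i ih =>
      intro hi
      obtain ⟨x, hx, hgx⟩ := hsurj i (by omega)
      have hxp : x < p := by
        by_contra! h
        have := hge x h hx
        omega
      rcases lt_trichotomy x i with h | h | h
      · have := ih x h (by omega)
        omega
      · rw [h] at hgx
        exact hgx
      · have h1 := hmono i x h hxp.le
        have h2 := ih (g i) (by omega) (by omega)
        have := hinj (g i) (by omega) i (by omega) h2
        omega
  have hfp : f ≤ p := by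
    by_contra! h
    have := hfix p h
    omega
  have hfge : ∀ i, f ≤ i → i < n → f ≤ g i := by
    intro i hi hin
    by_contra! h
    have := hinj (g i) (by omega) i hin (hfix _ h)
    omega
  obtain ⟨k, hk⟩ : ∃ k, g f = f + k := ⟨g f - f, by have := hfge f le_rfl hfn; omega⟩
  have hkn := hlt f hfn
  have htail : ∀ j < k, g (n - 1 - j) = f + j := by
    intro j
    induction j using Nat.strong_induction_on with
    | _ j ih =>
      intro hj
      obtain ⟨x, hx, hgx⟩ := hsurj (f + j) (by omega)
      have hxp : p ≤ x := by
        by_contra! h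
        rcases lt_or_ge x f with h1 | h1
        · have := hfix x h1
          omega
        · rcases h1.eq_or_lt with rfl | h1
          · omega
          · have := hmono f x h1 h.le
            omega
      rcases lt_trichotomy x (n - 1 - j) with h | h | h
      · have h1 := hanti x (n - 1 - j) hxp h (by omega)
        have h2 := hge (n - 1 - j) (by omega) (by omega)
        have h3 := ih (g (n - 1 - j) - f) (by omega) (by omega)
        have := hinj (n - 1 - (g (n - 1 - j) - f)) (by omega) (n - 1 - j) (by omega) (by omega)
        omega
      · rw [← h]
        exact hgx
      · have h1 := ih (n - 1 - x) (by omega) (by omega)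
        rw [show n - 1 - (n - 1 - x) = x by omega] at h1
        omega
  rcases hfp.eq_or_lt with rfl | hfp
  · refine ⟨f, 0, n - f, by omega, by simp; omega, fun i hi => ?_⟩
    have hb := blockMap_cases f 0 0 (n - f) i (by omega)
    rw [Nat.zero_min]
    rcases lt_trichotomy i f with h | rfl | h
    · have := hfix i h
      omega
    · omega
    · have := htail (n - 1 - i) (by omega)
      rw [show n - 1 - (n - 1 - i) = i by omega] at this
      omega
  have hk1 : 1 ≤ k := by
    by_contra! h
    have := hinj f hfn (n - 1) (by omega) (by omega)
    omega
  have hsep : ∀ x z, f ≤ x → x < p → p < z → z < n → g (g z) < g (g x) := by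
    intro x z hfx hxp hpz hz
    have h1 := hsq x p z hxp hpz hz
    rw [hp, hf] at h1
    have h2 := hfge (g x) (hfge x hfx (by omega)) (hlt x (by omega))
    have h3 : g (g x) ≠ f := fun h => by
      have h4 := hinj (g x) (hlt x (by omega)) (n - 1) (by omega) (h.trans hf.symm)
      have := hle x (by omega) (by omega)
      omega
    have h5 : g (g x) ≠ g (g z) := fun h => by
      have h6 := hinj _ (hlt x (by omega)) _ (hlt z hz) h
      have := hinj x (by omega) z hz h6
      omega
    omega
  have hinc : ∀ i, f + i < p → g (f + i) = f + k + i := by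
    intro i
    induction i with
    | zero => exact fun _ => hk
    | succ i ih =>
      intro hi
      have hu := ih (by omega)
      have h1 := hmono (f + i) (f + (i + 1)) (by omega) hi.le
      by_contra hne
      have h2 := hle (f + (i + 1)) (by omega) (by omega)
      obtain ⟨x, hx, hgx⟩ := hsurj (f + k + i + 1) (by omega)
      have hxp : p < x := by
        by_contra! h
        have : x ≠ p := fun h => by rw [h] at hgx; omega
        rcases lt_trichotomy x (f + (i + 1)) with h3 | h3 | h3
        · rcases (show x ≤ f + i by omega).eq_or_lt with h4 | h4
          · rw [h4] at hgx; omega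
          · have := hmono x (f + i) h4 (by omega)
            omega
        · rw [h3] at hgx; omega
        · have := hmono _ x h3 h
          omega
      have h3 := hsep (f + i) x (by omega) (by omega) hxp hx
      have h4 := hsep (f + (i + 1)) x (by omega) (by omega) hxp hx
      exact hval (g (f + i)) (g x) (g (f + (i + 1))) (by omega) (by omega)
        (hlt _ (by omega)) ⟨h3, h4⟩
  have htp : p + k < n := by
    by_contra! h
    have h1 := htail (n - 1 - p) (by omega)
    rw [show n - 1 - (n - 1 - p) = p by omega] at h1
    omega
  have hdec : ∀ j, p + j + k < n → g (p + j) = n - 1 - j := by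
    intro j
    induction j using Nat.strong_induction_on with
    | _ j ih =>
      intro hj
      obtain ⟨x, hx, hgx⟩ := hsurj (n - 1 - j) (by omega)
      have hxp : p ≤ x := by
        by_contra! h
        rcases lt_or_ge x f with h1 | h1
        · have := hfix x h1
          omega
        · have := hinc (x - f) (by omega)
          rw [show f + (x - f) = x by omega] at this
          omega
      rcases lt_trichotomy x (p + j) with h | h | h
      · have := ih (x - p) (by omega) (by omega)
        rw [show p + (x - p) = x by omega] at this
        omega
      · rw [← h]
        exact hgx
      · have h1 := hanti (p + j) x (by omega) h hx
        have h2 := hlt (p + j) (by omega)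
        have h3 := ih (n - 1 - g (p + j)) (by omega) (by omega)
        have := hinj (p + (n - 1 - g (p + j))) (by omega) (p + j) (by omega) (by omega)
        omega
  have hblock : ∀ i < n, g i = blockMap f k (p - f) (n - k - p) i := by
    intro i hi
    have hb := blockMap_cases f k (p - f) (n - k - p) i (by omega)
    rcases lt_or_ge i f with h1 | h1
    · have := hfix i h1
      omega
    rcases lt_or_ge i p with h2 | h2
    · have := hinc (i - f) (by omega)
      rw [show f + (i - f) = i by omega] at this
      omega
    rcases lt_or_ge i (n - k) with h3 | h3
    · have := hdec (i - p) (by omega)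
      rw [show p + (i - p) = i by omega] at this
      omega
    · have := htail (n - 1 - i) (by omega)
      rw [show n - 1 - (n - 1 - i) = i by omega] at this
      omega
  have hmin := eq_min_of_blockMap_sq_avoids f k (p - f) (n - k - p) hk1 (by omega) (by omega) (by
    intro x y z hxy hyz hz
    have := hsq x y z hxy hyz (by omega)
    have hx' := hlt x (by omega)
    have hy' := hlt y (by omega)
    have hz' := hlt z (by omega)
    rwa [hblock _ hx', hblock _ hy', hblock _ hz', hblock x (by omega), hblock y (by omega),
      hblock z (by omega)] at this)
  refine ⟨f, p - f, n - k - p, by omega, by omega, ?_⟩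
  rw [← hmin]
  exact hblock

/-- The pairs of block lengths which parametrize the permutations being counted. -/
def blockPairs (n : ℕ) : Finset (ℕ × ℕ) :=
  (Finset.range (n + 1) ×ˢ Finset.range (n + 1)).filter
    fun q => 1 ≤ q.2 ∧ q.1 + q.2 + min q.1 q.2 ≤ n

theorem mem_blockPairs {n : ℕ} {q : ℕ × ℕ} :
    q ∈ blockPairs n ↔ 1 ≤ q.2 ∧ q.1 + q.2 + min q.1 q.2 ≤ n := by
  simp only [blockPairs, Finset.mem_filter, Finset.mem_product, Finset.mem_range]
  omega

theorem card_blockPairs_add_three (n : ℕ) :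
    (blockPairs (n + 3)).card = (blockPairs n).card + 2 * n + 4 := by
  have h : blockPairs (n + 3) =
      ((blockPairs n).image fun q => (q.1 + 1, q.2 + 1)) ∪
        (((Finset.range (n + 3)).image fun d => (0, d + 1)) ∪
          ((Finset.range (n + 1)).image fun l => (l + 1, 1))) := by
    ext ⟨l, d⟩
    simp only [mem_blockPairs, Finset.mem_union, Finset.mem_image, Finset.mem_range, Prod.exists,
      Prod.mk.injEq]
    constructor
    · rintro ⟨h1, h2⟩
      rcases Nat.eq_zero_or_pos l with rfl | hl
      · exact .inr (.inl ⟨d - 1, by omega, by omega, by omega⟩)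
      rcases h1.eq_or_lt with rfl | hd
      · exact .inr (.inr ⟨l - 1, by omega, by omega, by omega⟩)
      · exact .inl ⟨l - 1, d - 1, by omega, by omega, by omega⟩
    · rintro (⟨a, b, h⟩ | ⟨a, h⟩ | ⟨a, h⟩) <;> omega
  rw [h, Finset.card_union_of_disjoint, Finset.card_union_of_disjoint,
    Finset.card_image_of_injective, Finset.card_image_of_injective,
    Finset.card_image_of_injective, Finset.card_range, Finset.card_range]
  · ring
  · intro a b h; simpa using h
  · intro a b h; simpa using h
  · rintro ⟨a, b⟩ ⟨a', b'⟩ h; simpa using h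
  · rw [Finset.disjoint_left]
    rintro ⟨a, b⟩ h1 h2
    simp only [Finset.mem_image, Prod.mk.injEq] at h1 h2
    obtain ⟨_, _, h1⟩ := h1
    obtain ⟨_, _, h2⟩ := h2
    omega
  · rw [Finset.disjoint_left]
    rintro ⟨a, b⟩ h1 h2
    simp only [Finset.mem_union, Finset.mem_image, Prod.mk.injEq, Prod.exists,
      mem_blockPairs] at h1 h2
    obtain ⟨_, _, _, h1⟩ := h1
    rcases h2 with ⟨_, _, h2⟩ | ⟨_, _, h2⟩ <;> omega

theorem card_blockPairs (n : ℕ) (hn : 1 ≤ n) :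
    (blockPairs n).card = (n * (n + 1) + 2) / 3 := by
  induction n using Nat.strong_induction_on with
  | _ n ih =>
    obtain rfl | rfl | rfl | h : n = 1 ∨ n = 2 ∨ n = 3 ∨ 4 ≤ n := by omega
    · decide
    · decide
    · decide
    · obtain ⟨m, rfl⟩ : ∃ m, n = m + 3 := ⟨n - 3, by omega⟩
      rw [card_blockPairs_add_three, ih m (by omega) (by omega),
        show (m + 3) * (m + 3 + 1) + 2 = m * (m + 1) + 2 + 3 * (2 * m + 4) by ring]
      omega

/-- `blockMap` as a permutation of `Fin n`. -/
noncomputable def blockPerm {n f k l d : ℕ} (h : f + l + d + k = n) : Equiv.Perm (Fin n) :=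
  Equiv.ofBijective
    (fun i => ⟨blockMap f k l d i, by have := blockMap_lt f k l d i (by omega); omega⟩)
    (Finite.injective_iff_bijective.1 fun i j hij => Fin.ext <|
      blockMap_inj f k l d i j (by omega) (by omega) (congrArg Fin.val hij))

theorem blockPerm_val {n f k l d : ℕ} (h : f + l + d + k = n) (i : Fin n) :
    (blockPerm h i : ℕ) = blockMap f k l d i := rfl

theorem blockPerm_avoids {n f l d : ℕ} (h : f + l + d + min l d = n) :
    PermAvoids (blockPerm h) p213 ∧ PermAvoids (blockPerm h) p312 ∧
      PermAvoids (blockPerm h ^ 2) p213 := by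
  rw [← and_assoc, permAvoids_p213_and_p312_iff, permAvoids_p213_iff]
  constructor
  · intro x y z hxy hyz
    simp only [Fin.lt_def, blockPerm_val] at *
    exact blockMap_no_valley f _ l d x y z hxy hyz (by omega)
  · intro x y z hxy hyz
    simp only [Fin.lt_def, pow_two, Equiv.Perm.mul_apply, blockPerm_val] at *
    exact blockMap_sq_avoids f l d x y z hxy hyz (by omega)

theorem exists_eq_blockPerm {n : ℕ} (hn : 1 ≤ n) (π : Equiv.Perm (Fin n))
    (h : PermAvoids π p213 ∧ PermAvoids π p312 ∧ PermAvoids (π ^ 2) p213) :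
    ∃ f l d, ∃ h : f + l + d + min l d = n, 1 ≤ d ∧ π = blockPerm h := by
  rw [← and_assoc, permAvoids_p213_and_p312_iff, permAvoids_p213_iff] at h
  obtain ⟨hval, hsq⟩ := h
  obtain ⟨g, hg⟩ : ∃ g : ℕ → ℕ, ∀ i : Fin n, g i = π i :=
    ⟨fun i => if hi : i < n then π ⟨i, hi⟩ else i, fun i => by simp⟩
  have hg' : ∀ i (hi : i < n), g i = π ⟨i, hi⟩ := fun i hi => hg ⟨i, hi⟩
  obtain ⟨f, l, d, hd, hs, hb⟩ := exists_eq_blockMap n hn g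
    (fun i hi => by rw [hg' i hi]; exact (π _).2)
    (fun i hi j hj hij => by
      rw [hg' i hi, hg' j hj] at hij
      simpa using π.injective (Fin.ext hij))
    (fun v hv => ⟨π.symm ⟨v, hv⟩, (π.symm _).2, by rw [hg]; simp⟩)
    (fun x y z hxy hyz hz => by
      rw [hg' x (by omega), hg' y (by omega), hg' z hz]
      exact hval _ _ _ hxy hyz)
    (fun x y z hxy hyz hz => by
      rw [hg' x (by omega), hg' y (by omega), hg' z hz, hg, hg, hg]
      exact hsq _ _ _ hxy hyz)
  refine ⟨f, l, d, hs, hd, Equiv.ext fun i => Fin.ext ?_⟩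
  rw [blockPerm_val, ← hg, hb i i.2]

theorem blockPerm_injective {n f l d f' l' d' : ℕ} (h : f + l + d + min l d = n)
    (h' : f' + l' + d' + min l' d' = n) (hd : 1 ≤ d) (hd' : 1 ≤ d')
    (he : blockPerm h = blockPerm h') : l = l' ∧ d = d' := by
  have key : ∀ i < n, blockMap f (min l d) l d i = blockMap f' (min l' d') l' d' i :=
    by
    intro i hi
    exact congrArg Fin.val (DFunLike.congr_fun he ⟨i, hi⟩)
  have e1 := key (n - 1) (by omega)
  have e2 := key (f + l) (by omega)
  have c1 := blockMap_cases f (min l d) l d (n - 1) (by omega)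
  have c2 := blockMap_cases f' (min l' d') l' d' (n - 1) (by omega)
  have c3 := blockMap_cases f (min l d) l d (f + l) (by omega)
  have c4 := blockMap_cases f' (min l' d') l' d' (f + l) (by omega)
  have hf : f = f' := by omega
  have hl : l = l' := by omega
  omega

theorem stmt2 (n : ℕ) (hn : 1 ≤ n) :
    Nat.card {π : Equiv.Perm (Fin n) //
      PermAvoids π p213 ∧ PermAvoids π p312 ∧ PermAvoids (π ^ 2) p213} =
      (n * (n + 1) + 2) / 3 := by
  have hsum : ∀ q ∈ blockPairs n,
      n - (q.1 + q.2 + min q.1 q.2) + q.1 + q.2 + min q.1 q.2 = n := by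
    intro q hq
    have := mem_blockPairs.1 hq
    omega
  rw [← card_blockPairs n hn, ← Nat.card_eq_finsetCard]
  refine (Nat.card_congr (Equiv.ofBijective
    (fun q : blockPairs n => ⟨blockPerm (hsum q q.2), blockPerm_avoids _⟩) ⟨?_, ?_⟩)).symm
  · rintro ⟨⟨l, d⟩, hq⟩ ⟨⟨l', d'⟩, hq'⟩ h
    obtain ⟨rfl, rfl⟩ := blockPerm_injective (hsum _ hq) (hsum _ hq') (mem_blockPairs.1 hq).1
      (mem_blockPairs.1 hq').1 (congrArg Subtype.val h)
    rfl
  · rintro ⟨π, hπ⟩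
    obtain ⟨f, l, d, h, hd, rfl⟩ := exists_eq_blockPerm hn π hπ
    refine ⟨⟨(l, d), mem_blockPairs.2 ⟨hd, by dsimp only; omega⟩⟩, ?_⟩
    obtain rfl : f = n - (l + d + min l d) := by omega
    rfl
end

section
/- For every integer n ≥ 1, the number of permutations π in S_n such that π avoids both of the patterns 213 and 312 and π² avoids the pattern 231 equals ⌈n(n+1)/3⌉. -/
/-- `f` restricts to a permutation of `{0, …, n - 1}` that has no valley (it avoids 213 and 312)
and whose square avoids 231. -/
structure IsGood (n : ℕ) (f : ℕ → ℕ) : Prop where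
  maps : ∀ x < n, f x < n
  inj : ∀ x < n, ∀ y < n, f x = f y → x = y
  surj : ∀ v < n, ∃ x < n, f x = v
  valley : ∀ x y z, x < y → y < z → z < n → ¬(f y < f x ∧ f y < f z)
  avoid : ∀ x y z, x < y → y < z → z < n → ¬(f (f z) < f (f x) ∧ f (f x) < f (f y))

/-- The good permutation of `{0, …, m - 1}` with first value `t` and last value `0`. -/
def model (m t x : ℕ) : ℕ :=
  if x < min t (m - 1 - t) then t + x
  else if x < m - t then m - 1 - (x - min t (m - 1 - t))
  else m - 1 - x

/-- The good permutation of `{0, …, n - 1}` that fixes exactly the first `c` points pointwise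
and continues with a translate of `model`. -/
def shiftedModel (n c t x : ℕ) : ℕ :=
  if x < c then x else c + model (n - c) t (x - c)

/-- A strictly increasing sequence either runs through consecutive values
or has a first jump. -/
theorem consecutive_or_jump (f : ℕ → ℕ) (q : ℕ) (hf : ∀ x y, x < y → y < q → f x < f y) :
    (∀ i < q, f i = f 0 + i) ∨
      ∃ k, 1 ≤ k ∧ k < q ∧ (∀ i < k, f i = f 0 + i) ∧ f 0 + k < f k := by
  induction q with
  | zero => left; intro i hi; omega
  | succ q ih =>
    rcases ih (fun x y h h' => hf x y h (by omega)) with h | ⟨k, h1, h2, h3, h4⟩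
    · by_cases hq : f q = f 0 + q
      · left
        intro i hi
        rcases Nat.lt_succ_iff_lt_or_eq.mp hi with h' | rfl
        · exact h i h'
        · exact hq
      · right
        rcases Nat.eq_zero_or_pos q with rfl | hpos
        · simp at hq
        · refine ⟨q, hpos, by omega, h, ?_⟩
          have h5 := hf (q - 1) q (by omega) (by omega)
          have h6 := h (q - 1) (by omega)
          omega
    · exact Or.inr ⟨k, h1, by omega, h3, h4⟩

theorem add_sub_le_of_increasing_s3 (f : ℕ → ℕ) (q : ℕ) (hf : ∀ x y, x < y → y < q → f x < f y)
    (x d : ℕ) (h : x + d < q) : f x + d ≤ f (x + d) := by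
  induction d with
  | zero => simp
  | succ d ih =>
    have h1 := ih (by omega)
    have h2 := hf (x + d) (x + (d + 1)) (by omega) h
    omega

theorem add_le_of_decreasing (f : ℕ → ℕ) (p m : ℕ)
    (hf : ∀ x y, p ≤ x → x < y → y < m → f y < f x) (d : ℕ) (h : p + d < m) :
    f (p + d) + d ≤ f p := by
  induction d with
  | zero => simp
  | succ d ih =>
    have h1 := ih (by omega)
    have h2 := hf (p + d) (p + (d + 1)) (by omega) (by omega) h
    omega

namespace IsGood

variable {n m : ℕ} {f : ℕ → ℕ}

theorem fixed_prefix (h : IsGood n f) (x : ℕ) (hx : x < f (n - 1)) (hn : 1 ≤ n) : f x = x := by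
  induction x using Nat.strong_induction_on with
  | _ x ih =>
    have hc := h.maps (n - 1) (by omega)
    obtain ⟨z, hz, hzx⟩ := h.surj x (by omega)
    have hxz : x ≤ z := by
      by_contra! hlt
      have := ih z hlt (by omega)
      omega
    rcases hxz.eq_or_lt with rfl | hlt
    · exact hzx
    · exfalso
      have hzl : z ≠ n - 1 := by rintro rfl; omega
      have h1 : ¬ f x < x := by
        intro h2
        have h3 := ih (f x) h2 (by omega)
        have := h.inj _ (by omega) _ (by omega) h3
        omega
      have h2 : f x ≠ x := by
        intro h2
        have := h.inj x (by omega) z hz (by omega)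
        omega
      exact h.valley x z (n - 1) hlt (by omega) (by omega) ⟨by omega, by omega⟩

/-- Removing the initial fixed points of a good permutation leaves a good permutation. -/
theorem remove_prefix (h : IsGood n f) (hn : 1 ≤ n) :
    IsGood (n - f (n - 1)) (fun y => f (f (n - 1) + y) - f (n - 1)) := by
  have hfix := fun x hx => h.fixed_prefix x hx hn
  have hge : ∀ x, f (n - 1) ≤ x → x < n → f (n - 1) ≤ f x := by
    intro x hx hxn
    by_contra! hlt
    have := h.inj _ (by omega) _ hxn (hfix _ hlt)
    omega
  generalize f (n - 1) = c at *
  have hge' : ∀ y, y < n - c → c ≤ f (c + y) ∧ f (c + y) < n :=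
    fun y hy => ⟨hge _ (by omega) (by omega), h.maps _ (by omega)⟩
  have hsq : ∀ y, y < n - c → c + (f (c + y) - c) = f (c + y) := fun y hy => by
    have := hge' y hy
    omega
  have hsq' : ∀ y, y < n - c → c ≤ f (f (c + y)) := fun y hy =>
    hge _ (hge' y hy).1 (hge' y hy).2
  refine ⟨?_, ?_, ?_, ?_, ?_⟩
  · intro x hx
    have := hge' x hx
    omega
  · intro x hx y hy hxy
    have h1 := hge' x hx
    have h2 := hge' y hy
    have := h.inj (c + x) (by omega) (c + y) (by omega) (by omega)
    omega
  · intro v hv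
    obtain ⟨x, hx, hxv⟩ := h.surj (c + v) (by omega)
    have hcx : c ≤ x := by
      by_contra! hlt
      have := hfix x hlt
      omega
    refine ⟨x - c, by omega, ?_⟩
    rw [Nat.add_sub_cancel' hcx]
    omega
  · intro x y z hxy hyz hz ⟨h1, h2⟩
    have := hge' x (by omega)
    have := hge' y (by omega)
    have := hge' z (by omega)
    exact h.valley (c + x) (c + y) (c + z) (by omega) (by omega) (by omega)
      ⟨by omega, by omega⟩
  · intro x y z hxy hyz hz ⟨h1, h2⟩
    rw [hsq x (by omega)] at h1 h2
    rw [hsq y (by omega)] at h2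
    rw [hsq z (by omega)] at h1
    have := hsq' x (by omega)
    have := hsq' y (by omega)
    have := hsq' z (by omega)
    exact h.avoid (c + x) (c + y) (c + z) (by omega) (by omega) (by omega)
      ⟨by omega, by omega⟩

theorem increasing (h : IsGood m f) {p : ℕ} (hp : p < m) (hfp : f p = m - 1) (x y : ℕ)
    (hxy : x < y) (hy : y < p + 1) : f x < f y := by
  have hx := h.maps x (by omega)
  have hne : f x ≠ f y := fun e => by
    have := h.inj x (by omega) y (by omega) e
    omega
  rcases Nat.lt_succ_iff_lt_or_eq.mp hy with hlt | rfl
  · by_contra! hle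
    exact h.valley x y p hxy hlt hp ⟨by omega, by omega⟩
  · omega

theorem decreasing (h : IsGood m f) {p : ℕ} (hfp : f p = m - 1) (x y : ℕ)
    (hpx : p ≤ x) (hxy : x < y) (hy : y < m) : f y < f x := by
  have hx := h.maps y hy
  have hne : f x ≠ f y := fun e => by
    have := h.inj x (by omega) y (by omega) e
    omega
  rcases hpx.eq_or_lt with rfl | hlt
  · omega
  · by_contra! hle
    exact h.valley p x y hlt hxy hy ⟨by omega, by omega⟩

theorem tail (h : IsGood m f) {p : ℕ} (hp : p < m) (hfp : f p = m - 1) (v : ℕ) (hv : v < f 0) :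
    f (m - 1 - v) = v := by
  induction v using Nat.strong_induction_on with
  | _ v ih =>
    have h0 := h.maps 0 (by omega)
    obtain ⟨x, hx, hxv⟩ := h.surj v (by omega)
    have hpx : p < x := by
      by_contra! hle
      rcases Nat.eq_zero_or_pos x with rfl | hpos
      · omega
      · have := h.increasing hp hfp 0 x hpos (by omega)
        omega
    have hxle : x ≤ m - 1 - v := by
      by_contra! hlt
      have h1 := ih (m - 1 - x) (by omega) (by omega)
      rw [show m - 1 - (m - 1 - x) = x by omega] at h1
      omega
    rcases hxle.eq_or_lt with rfl | hlt
    · exact hxv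
    · exfalso
      have h1 := h.decreasing hfp x (m - 1 - v) hpx.le hlt (by omega)
      have h2 := ih (f (m - 1 - v)) (by omega) (by omega)
      have := h.inj _ (by omega) _ (by omega) h2
      omega

/-- The least value above `f 0` missing from the increasing part sits just before the tail. -/
theorem position_of_first_missing (h : IsGood m f) {p v : ℕ} (hp : p < m) (hfp : f p = m - 1)
    (hv : f 0 < v) (hvm : v < m) (hmiss : ∀ i ≤ p, f i ≠ v)
    (hleast : ∀ w, f 0 ≤ w → w < v → ∃ i ≤ p, f i = w) :
    f (m - 1 - f 0) = v ∧ p < m - 1 - f 0 := by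
  obtain ⟨x, hx, hxv⟩ := h.surj v hvm
  have hpx : p < x := by
    by_contra! hle
    exact hmiss x hle hxv
  have hxle : x ≤ m - 1 - f 0 := by
    by_contra! hlt
    have h1 := h.tail hp hfp (m - 1 - x) (by omega)
    rw [show m - 1 - (m - 1 - x) = x by omega] at h1
    omega
  rcases hxle.eq_or_lt with rfl | hlt
  · exact ⟨hxv, hpx⟩
  · exfalso
    have h1 := h.decreasing hfp x (m - 1 - f 0) hpx.le hlt (by omega)
    by_cases h2 : f (m - 1 - f 0) < f 0
    · have h3 := h.tail hp hfp _ h2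
      have := h.inj _ (by omega) _ (by omega) h3
      omega
    · obtain ⟨i, hi, hif⟩ := hleast _ (not_lt.mp h2) (by omega)
      have := h.inj _ (by omega) _ (by omega) hif
      omega

/-- Values of the square above its last value occur in decreasing order. -/
theorem square_decreasing (h : IsGood m f) (hlast : f (m - 1) = 0) (x y : ℕ) (hxy : x < y)
    (hy : y < m) (hx0 : f 0 < f (f x)) (hy0 : f 0 < f (f y)) : f (f y) < f (f x) := by
  have hne : f (f x) ≠ f (f y) := fun e => by
    have h1 := h.inj _ (h.maps x (by omega)) _ (h.maps y hy) e
    have := h.inj x (by omega) y hy h1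
    omega
  have hyl : y ≠ m - 1 := by
    rintro rfl
    rw [hlast] at hy0
    omega
  by_contra! hle
  refine h.avoid x y (m - 1) hxy (by omega) (by omega) ⟨?_, by omega⟩
  rw [hlast]
  exact hx0

theorem eq_model_of_peak_lt (h : IsGood m f) {p : ℕ} (hp : p < m) (hfp : f p = m - 1)
    (hlast : f (m - 1) = 0) (hpt : p < f 0) :
    m - 1 ≤ 3 * f 0 ∧ ∀ x < m, f x = model m (f 0) x := by
  have hinc := h.increasing hp hfp
  have htail := h.tail hp hfp
  have h0 := h.maps 0 (by omega)
  have himage : ∀ w, f 0 ≤ w → w < m → ∃ i ≤ p, f i = w := by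
    intro w hw hwm
    rcases hw.eq_or_lt with rfl | hlt
    · exact ⟨0, by omega, rfl⟩
    obtain ⟨u, hu, huw⟩ := h.surj w hwm
    obtain ⟨x, hx, hxu⟩ := h.surj u hu
    have hxp : m - 1 - p ≤ x := by
      by_contra! hlt'
      have h1 := h.square_decreasing hlast x (m - 1 - p) hlt' (by omega)
      rw [htail p hpt, hfp, hxu, huw] at h1
      have := h1 hlt (by have := h.maps u hu; omega)
      omega
    refine ⟨m - 1 - x, by omega, ?_⟩
    have h2 := htail (m - 1 - x) (by omega)
    rw [show m - 1 - (m - 1 - x) = x by omega] at h2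
    rw [← h2, hxu, huw]
  have hcons : ∀ i < p + 1, f i = f 0 + i := by
    rcases consecutive_or_jump f (p + 1) hinc with h1 | ⟨k, hk1, hkp, hk, hjump⟩
    · exact h1
    · exfalso
      have hkm := h.maps k (by omega)
      obtain ⟨i, hi, hif⟩ := himage (f 0 + k) (by omega) (by omega)
      rcases lt_trichotomy i k with hik | rfl | hik
      · have := hk i hik
        omega
      · omega
      · have := hinc k i hik (by omega)
        omega
  have hpm := hcons p (by omega)
  refine ⟨by omega, fun x hx => ?_⟩
  unfold model
  rw [min_eq_right (by omega)]
  split_ifs with h1 h2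
  · exact hcons x (by omega)
  · obtain rfl : x = p := by omega
    omega
  · have h3 := htail (m - 1 - x) (by omega)
    rw [show m - 1 - (m - 1 - x) = x by omega] at h3
    exact h3

theorem peak_le_first_value (h : IsGood m f) {p : ℕ} (hp : p < m) (hfp : f p = m - 1)
    (hlast : f (m - 1) = 0) (ht : 1 ≤ f 0) : p ≤ f 0 := by
  by_contra! htp
  have hinc := h.increasing hp hfp
  have h1m := h.maps 1 (by omega)
  have h1 := hinc 0 1 (by omega) (by omega)
  have hpf : p < f 1 := by
    by_contra! hle
    have h2 := hinc (f 0) (f 1) h1 (by omega)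
    refine h.avoid 0 1 p (by omega) (by omega) hp ⟨?_, h2⟩
    rw [hfp, hlast]
    have := hinc 0 (f 0) (by omega) (by omega)
    omega
  obtain ⟨h3, h4⟩ := h.position_of_first_missing (v := f 0 + 1) hp hfp (by omega) (by omega)
    (by
      intro i hi e
      rcases Nat.lt_or_ge 1 i with hi1 | hi1
      · have := hinc 1 i hi1 (by omega)
        omega
      · interval_cases i <;> omega)
    (fun w hw hw' => ⟨0, by omega, by omega⟩)
  have h5 := hinc 0 (f 0) (by omega) (by omega)
  have h6 := hinc (f 0) (f 0 + 1) (by omega) (by omega)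
  have h7 := h.square_decreasing hlast 0 (m - 1 - f 0) (by omega) (by omega) h5
    (by rw [h3]; omega)
  rw [h3] at h7
  omega

theorem consecutive_of_peak_eq (h : IsGood m f) (hp : f 0 < m) (hfp : f (f 0) = m - 1)
    (hlast : f (m - 1) = 0) : ∀ i < f 0, f i = f 0 + i := by
  have hinc := h.increasing hp hfp
  have hdec := h.decreasing hfp
  have htail := h.tail hp hfp
  rcases consecutive_or_jump f (f 0) (fun x y hx hy => hinc x y hx (by omega)) with
    h1 | ⟨k, hk1, hkp, hk, hjump⟩
  · exact h1
  exfalso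
  have hkm := h.maps k (by omega)
  obtain ⟨hpos, hlt⟩ := h.position_of_first_missing (v := f 0 + k) hp hfp (by omega) (by omega)
    (by
      intro i hi e
      rcases lt_trichotomy i k with hik | rfl | hik
      · have := hk i hik
        omega
      · omega
      · have := hinc k i hik (by omega)
        omega)
    (fun w hw hw' => ⟨w - f 0, by omega, by
      rw [hk (w - f 0) (by omega)]; omega⟩)
  have htop : f (m - f 0) = f 0 - 1 := by
    have := htail (f 0 - 1) (by omega)
    rwa [show m - 1 - (f 0 - 1) = m - f 0 by omega] at this
  have htop0 : f 0 < f (f 0 - 1) := hinc 0 (f 0 - 1) (by omega) (by omega)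
  have hgrow := add_sub_le_of_increasing_s3 f (f 0 + 1) hinc k (f 0 - 1 - k) (by omega)
  rw [show k + (f 0 - 1 - k) = f 0 - 1 by omega] at hgrow
  rcases Nat.lt_or_ge (m - 1 - f 0) (f 0 + k) with hcase | hcase
  · have h2 := hk (m - 1 - f 0 - f 0) (by omega)
    rw [show f 0 + (m - 1 - f 0 - f 0) = m - 1 - f 0 by omega] at h2
    have h3 := h.square_decreasing hlast (m - 1 - f 0 - f 0) (m - f 0) (by omega) (by omega)
      (by rw [h2, hpos]; omega) (by rw [htop]; exact htop0)
    rw [h2, hpos, htop] at h3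
    omega
  · have hbig : f 0 < f (f 0 + k) := by
      rcases hcase.eq_or_lt with e | hlt'
      · rw [e, hpos]; omega
      · have := hdec (f 0 + k) (m - 1 - f 0) (by omega) hlt' (by omega)
        omega
    have h2 := h.square_decreasing hlast (m - 1 - f 0) (m - f 0) (by omega) (by omega)
      (by rw [hpos]; exact hbig) (by rw [htop]; exact htop0)
    rw [hpos, htop] at h2
    have h3 := add_le_of_decreasing f (f 0) m hdec k (by omega)
    have hsmall : f (f k) ≤ f 0 := by
      by_contra! hgt
      have h4 := h.square_decreasing hlast k (m - 1 - f 0) (by omega) (by omega) hgt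
        (by rw [hpos]; exact hbig)
      rw [hpos] at h4
      have := hdec (f 0 + k) (f k) (by omega) hjump hkm
      omega
    have h5 : m - 1 - f 0 < f k := by
      by_contra! hle
      rcases hle.eq_or_lt with e | hlt'
      · rw [e] at hsmall
        omega
      · have := hdec (f k) (m - 1 - f 0) (by omega) hlt' (by omega)
        omega
    omega

theorem eq_model_of_peak_eq (h : IsGood m f) (hp : f 0 < m) (hfp : f (f 0) = m - 1)
    (hlast : f (m - 1) = 0) (ht : 1 ≤ f 0) :
    m - 1 ≤ 3 * f 0 ∧ ∀ x < m, f x = model m (f 0) x := by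
  have hinc := h.increasing hp hfp
  have hdec := h.decreasing hfp
  have htail := h.tail hp hfp
  have hcons := h.consecutive_of_peak_eq hp hfp hlast
  have hlen : 2 * f 0 ≤ m - 1 := by
    have h1 := hcons (f 0 - 1) (by omega)
    have h2 := hinc (f 0 - 1) (f 0) (by omega) (by omega)
    omega
  have hmid : ∀ j, j ≤ m - 1 - 2 * f 0 → f (f 0 + j) = m - 1 - j := by
    intro j
    induction j with
    | zero => simpa using hfp
    | succ j ih =>
      intro hj
      have h1 := ih (by omega)
      have h2 := hdec (f 0 + j) (f 0 + (j + 1)) (by omega) (by omega) (by omega)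
      by_contra hne
      obtain ⟨x, hx, hxv⟩ := h.surj (m - 1 - (j + 1)) (by omega)
      have hx0 : f 0 ≤ x := by
        by_contra! hlt
        have := hcons x hlt
        omega
      rcases lt_trichotomy x (f 0 + (j + 1)) with hlt | rfl | hlt
      · rcases (show x ≤ f 0 + j by omega).eq_or_lt with rfl | hlt'
        · omega
        · have := hdec x (f 0 + j) hx0 hlt' (by omega)
          omega
      · omega
      · have := hdec _ x (by omega) hlt hx
        omega
  have hbound : m - 1 ≤ 3 * f 0 := by
    by_contra! hlt
    have h1 := hmid (m - 1 - 2 * f 0) le_rfl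
    have h2 := hmid (m - 2 - 2 * f 0) (by omega)
    have h3 := hmid (f 0) (by omega)
    have h4 := hmid (f 0 + 1) (by omega)
    rw [show f 0 + (m - 1 - 2 * f 0) = m - 1 - f 0 by omega,
      show m - 1 - (m - 1 - 2 * f 0) = f 0 + f 0 by omega] at h1
    rw [show f 0 + (m - 2 - 2 * f 0) = m - 2 - f 0 by omega,
      show m - 1 - (m - 2 - 2 * f 0) = f 0 + (f 0 + 1) by omega] at h2
    have h5 := h.square_decreasing hlast (m - 2 - f 0) (m - 1 - f 0) (by omega) (by omega)
      (by rw [h2, h4]; omega) (by rw [h1, h3]; omega)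
    rw [h1, h2, h3, h4] at h5
    omega
  refine ⟨hbound, fun x hx => ?_⟩
  unfold model
  rw [min_eq_left (by omega)]
  split_ifs with h1 h2
  · exact hcons x h1
  · have h3 := hmid (x - f 0) (by omega)
    rwa [show f 0 + (x - f 0) = x by omega] at h3
  · have h3 := htail (m - 1 - x) (by omega)
    rwa [show m - 1 - (m - 1 - x) = x by omega] at h3

theorem eq_model (h : IsGood m f) (hm : 1 ≤ m) (hlast : f (m - 1) = 0) :
    m - 1 ≤ 3 * f 0 ∧ ∀ x < m, f x = model m (f 0) x := by
  obtain ⟨p, hp, hfp⟩ := h.surj (m - 1) (by omega)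
  rcases Nat.lt_or_ge p (f 0) with hlt | hge
  · exact h.eq_model_of_peak_lt hp hfp hlast hlt
  rcases Nat.eq_zero_or_pos (f 0) with h0 | h0
  · have := h.inj 0 (by omega) (m - 1) (by omega) (by omega)
    obtain rfl : m = 1 := by omega
    refine ⟨by omega, fun x hx => ?_⟩
    obtain rfl : x = 0 := by omega
    simp [model, h0]
  · obtain rfl : p = f 0 := le_antisymm (h.peak_le_first_value hp hfp hlast h0) hge
    exact h.eq_model_of_peak_eq hp hfp hlast h0

theorem eq_shiftedModel (h : IsGood n f) (hn : 1 ≤ n) :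
    ∃ c t, c < n ∧ t < n - c ∧ n - c - 1 ≤ 3 * t ∧ ∀ x < n, f x = shiftedModel n c t x := by
  have hc := h.maps (n - 1) (by omega)
  have hg := h.remove_prefix hn
  have hfix := fun x hx => h.fixed_prefix x hx hn
  obtain ⟨h1, h2⟩ := hg.eq_model (by omega) (by
    rw [show f (n - 1) + (n - f (n - 1) - 1) = n - 1 by omega]
    omega)
  refine ⟨f (n - 1), _, hc, hg.maps 0 (by omega), h1, fun x hx => ?_⟩
  unfold shiftedModel
  split_ifs with hxc
  · exact hfix x hxc
  · rw [← h2 (x - f (n - 1)) (by omega), Nat.add_sub_cancel' (not_lt.mp hxc)]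
    have : f (n - 1) ≤ f x := by
      by_contra! hlt
      have := h.inj _ (by omega) _ hx (hfix _ hlt)
      omega
    omega

end IsGood

theorem model_lt {m t x : ℕ} (hx : x < m) (ht : t < m) : model m t x < m := by
  unfold model
  split_ifs <;> omega

theorem model_injective {m t x y : ℕ} (ht : t < m) (hx : x < m) (hy : y < m)
    (h : model m t x = model m t y) : x = y := by
  unfold model at h
  split_ifs at h <;> omega

theorem model_valley {m t x y z : ℕ} (ht : t < m) (hxy : x < y) (hyz : y < z) (hz : z < m) :
    ¬(model m t y < model m t x ∧ model m t y < model m t z) := by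
  unfold model
  split_ifs <;> omega

theorem model_square_of_le {m t x : ℕ} (ht : t < m) (hmt : m - 1 ≤ 2 * t) (hx : x < m) :
    model m t (model m t x) =
      if x = 0 ∧ m - 1 = 2 * t then m - 1
      else if x ≤ m - 1 - t then m - 1 - t - x
      else if x < t then x
      else m - 1 - (x - t) := by
  unfold model
  rw [min_eq_right (by omega)]
  split_ifs <;> omega

theorem model_square_of_lt {m t x : ℕ} (hmt : m - 1 ≤ 3 * t) (htm : 2 * t < m - 1)
    (hx : x < m) :
    model m t (model m t x) =
      if x < m - 2 * t ∧ x < t then m - 1 - x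
      else if x < t then m - 1 - t - x
      else if x < 2 * t ∧ x < m - t then x - t
      else if x < m - t then m - 1 - t
      else m - 1 - (x - t) := by
  unfold model
  rw [min_eq_left (by omega)]
  split_ifs <;> omega

theorem model_square_avoids {m t x y z : ℕ} (ht : t < m) (hmt : m - 1 ≤ 3 * t) (hxy : x < y)
    (hyz : y < z) (hz : z < m) :
    ¬(model m t (model m t z) < model m t (model m t x) ∧
      model m t (model m t x) < model m t (model m t y)) := by
  rcases Nat.lt_or_ge (2 * t) (m - 1) with h | h
  · rw [model_square_of_lt hmt h (by omega), model_square_of_lt hmt h (by omega),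
      model_square_of_lt hmt h (by omega)]
    split_ifs <;> omega
  · rw [model_square_of_le ht h (by omega), model_square_of_le ht h (by omega),
      model_square_of_le ht h (by omega)]
    split_ifs <;> omega

theorem shiftedModel_properties {n c t x y z : ℕ} (hc : c < n) (ht : t < n - c)
    (hmt : n - c - 1 ≤ 3 * t) :
    (x < n → shiftedModel n c t x < n) ∧
    (x < n → y < n → shiftedModel n c t x = shiftedModel n c t y → x = y) ∧
    (x < y → y < z → z < n →
      ¬(shiftedModel n c t y < shiftedModel n c t x ∧
        shiftedModel n c t y < shiftedModel n c t z)) ∧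
    (x < y → y < z → z < n →
      ¬(shiftedModel n c t (shiftedModel n c t z) < shiftedModel n c t (shiftedModel n c t x) ∧
        shiftedModel n c t (shiftedModel n c t x) <
          shiftedModel n c t (shiftedModel n c t y))) := by
  have hlow : ∀ u, u < c → shiftedModel n c t u = u := fun u hu => by simp [shiftedModel, hu]
  have hhigh : ∀ u, c ≤ u → shiftedModel n c t u = c + model (n - c) t (u - c) := fun u hu => by
    simp [shiftedModel, not_lt.mpr hu]
  have hsq : ∀ u, c ≤ u → shiftedModel n c t (shiftedModel n c t u) =
      c + model (n - c) t (model (n - c) t (u - c)) := fun u hu => by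
    rw [hhigh u hu, hhigh _ (by omega), Nat.add_sub_cancel_left]
  refine ⟨fun hx => ?_, fun hx hy h => ?_, fun hxy hyz hz => ?_, fun hxy hyz hz => ?_⟩
  · rcases Nat.lt_or_ge x c with h | h
    · rw [hlow x h]; exact hx
    · have := model_lt (x := x - c) (by omega) ht
      rw [hhigh x h]; omega
  · rcases Nat.lt_or_ge x c with h1 | h1 <;> rcases Nat.lt_or_ge y c with h2 | h2
    · rwa [hlow x h1, hlow y h2] at h
    · rw [hlow x h1, hhigh y h2] at h; omega
    · rw [hhigh x h1, hlow y h2] at h; omega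
    · rw [hhigh x h1, hhigh y h2] at h
      have := model_injective ht (show x - c < n - c by omega) (show y - c < n - c by omega)
        (by omega)
      omega
  · rcases Nat.lt_or_ge x c with h | h
    · rw [hlow x h]
      rcases Nat.lt_or_ge y c with h' | h'
      · rw [hlow y h']; omega
      · rw [hhigh y h']; omega
    · rw [hhigh x h, hhigh y (by omega), hhigh z (by omega)]
      have := model_valley (x := x - c) (y := y - c) (z := z - c) ht
        (by omega) (by omega) (by omega)
      omega
  · rcases Nat.lt_or_ge x c with h | h
    · rw [hlow x h, hlow x h]
      rcases Nat.lt_or_ge z c with h' | h'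
      · rw [hlow z h', hlow z h']; omega
      · rw [hsq z h']; omega
    · rw [hsq x h, hsq y (by omega), hsq z (by omega)]
      have := model_square_avoids (x := x - c) (y := y - c) (z := z - c) ht hmt
        (by omega) (by omega) (by omega)
      omega

theorem shiftedModel_last {n c t : ℕ} (hc : c < n) (hmt : n - c - 1 ≤ 3 * t) :
    shiftedModel n c t (n - 1) = c := by
  unfold shiftedModel model
  split_ifs <;> omega

theorem shiftedModel_first {n c t : ℕ} (ht : t < n - c) (hmt : n - c - 1 ≤ 3 * t) :
    shiftedModel n c t c = c + t := by
  unfold shiftedModel model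
  split_ifs <;> omega

/-- The parameters of the good permutations: `⟨m - 1, t⟩` where `m` is the number of points
after the initial fixed ones and `t` is the height of the first of them. -/
def params (n : ℕ) : Finset (Σ _ : ℕ, ℕ) :=
  (Finset.range n).sigma fun k => Finset.Ico ((k + 2) / 3) (k + 1)

theorem card_params (n : ℕ) : (params n).card = (n * (n + 1) + 2) / 3 := by
  rw [params, Finset.card_sigma]
  induction n with
  | zero => rfl
  | succ n ih =>
    rw [Finset.sum_range_succ, ih, Nat.card_Ico]
    obtain ⟨q, r, hr, rfl⟩ : ∃ q r, r < 3 ∧ n = 3 * q + r :=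
      ⟨n / 3, n % 3, Nat.mod_lt _ (by norm_num), by omega⟩
    interval_cases r <;> ring_nf <;> omega

/-- The permutation of `Fin n` given by a self-map of `{0, …, n - 1}` that is injective there. -/
noncomputable def permOfNat {n : ℕ} (f : ℕ → ℕ) (hf : ∀ x < n, f x < n)
    (hinj : ∀ x < n, ∀ y < n, f x = f y → x = y) : Equiv.Perm (Fin n) :=
  Equiv.ofBijective (fun x => ⟨f x, hf x x.2⟩) <| Finite.injective_iff_bijective.mp
    fun x y h => Fin.ext (hinj x x.2 y y.2 (congrArg Fin.val h))

/-- The action of a permutation of `Fin n` on natural numbers, extended by `0`. -/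
def natFun {n : ℕ} (π : Equiv.Perm (Fin n)) (x : ℕ) : ℕ :=
  if h : x < n then π ⟨x, h⟩ else 0

theorem natFun_val {n : ℕ} (π : Equiv.Perm (Fin n)) (x : Fin n) : natFun π x = π x := by
  simp [natFun]

theorem natFun_injective {n : ℕ} : Function.Injective (natFun (n := n)) := fun π ρ h =>
  Equiv.ext fun x => Fin.ext <| by rw [← natFun_val, ← natFun_val, h]

theorem natFun_permOfNat {n : ℕ} (f : ℕ → ℕ) (hf : ∀ x < n, f x < n)
    (hinj : ∀ x < n, ∀ y < n, f x = f y → x = y) {x : ℕ} (hx : x < n) :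
    natFun (permOfNat f hf hinj) x = f x := by
  simp [natFun, permOfNat, hx]

theorem permContains_three {n : ℕ} (π : Equiv.Perm (Fin n)) (τ : Equiv.Perm (Fin 3)) :
    PermContains π τ ↔ ∃ x y z : Fin n, x < y ∧ y < z ∧
      (τ 0 < τ 1 ↔ π x < π y) ∧ (τ 0 < τ 2 ↔ π x < π z) ∧ (τ 1 < τ 2 ↔ π y < π z) := by
  constructor
  · rintro ⟨f, hf, h⟩
    exact ⟨f 0, f 1, f 2, hf (by decide), hf (by decide), h 0 1, h 0 2, h 1 2⟩
  · rintro ⟨x, y, z, hxy, hyz, h1, h2, h3⟩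
    have flip : ∀ {i j : Fin 3} {u v : Fin n}, i ≠ j → u ≠ v →
        (τ i < τ j ↔ π u < π v) → (τ j < τ i ↔ π v < π u) := by
      intro i j u v hij huv h
      have a := τ.injective.ne hij
      have b := π.injective.ne huv
      omega
    refine ⟨![x, y, z], ?_, ?_⟩
    · rw [Fin.strictMono_iff_lt_succ]
      intro i
      fin_cases i
      · exact hxy
      · exact hyz
    · have h1' := flip (by decide) hxy.ne h1
      have h2' := flip (by decide) (hxy.trans hyz).ne h2
      have h3' := flip (by decide) hyz.ne h3
      intro i j
      fin_cases i <;> fin_cases j <;> simp <;> assumption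

theorem isGood_natFun {n : ℕ} (π : Equiv.Perm (Fin n))
    (hv : ∀ x y z, x < y → y < z → z < n →
      ¬(natFun π y < natFun π x ∧ natFun π y < natFun π z))
    (ha : ∀ x y z, x < y → y < z → z < n →
      ¬(natFun π (natFun π z) < natFun π (natFun π x) ∧
        natFun π (natFun π x) < natFun π (natFun π y))) :
    IsGood n (natFun π) := by
  refine ⟨?_, ?_, ?_, hv, ha⟩
  · intro x hx
    lift x to Fin n using hx
    rw [natFun_val]
    exact (π x).2
  · intro x hx y hy h
    lift x to Fin n using hx
    lift y to Fin n using hy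
    rw [natFun_val, natFun_val] at h
    exact congrArg Fin.val (π.injective (Fin.ext h))
  · intro v hv
    refine ⟨π.symm ⟨v, hv⟩, (π.symm ⟨v, hv⟩).2, ?_⟩
    rw [natFun_val, Equiv.apply_symm_apply]

theorem isGood_natFun_iff {n : ℕ} (π : Equiv.Perm (Fin n)) :
    IsGood n (natFun π) ↔
      PermAvoids π p213 ∧ PermAvoids π p312 ∧ PermAvoids (π ^ 2) p231 := by
  have hsq : ∀ x : Fin n, (π ^ 2) x = π (π x) := fun x => by rw [pow_two]; rfl
  have hne : ∀ x y : Fin n, x < y → (π x : ℕ) ≠ π y := fun x y h e =>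
    h.ne (π.injective (Fin.ext e))
  have hne2 : ∀ x y : Fin n, x < y → (π (π x) : ℕ) ≠ π (π y) := fun x y h e =>
    h.ne (π.injective (π.injective (Fin.ext e)))
  have e213 : p213 0 = 1 ∧ p213 1 = 0 ∧ p213 2 = 2 := by decide
  have e312 : p312 0 = 2 ∧ p312 1 = 0 ∧ p312 2 = 1 := by decide
  have e231 : p231 0 = 1 ∧ p231 1 = 2 ∧ p231 2 = 0 := by decide
  simp only [PermAvoids, permContains_three, hsq, e213, e312, e231, not_exists, Fin.lt_def,
    Fin.val_zero, Fin.val_one, Fin.val_two]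
  constructor
  · intro h
    have hv : ∀ x y z : Fin n, x < y → y < z → ¬((π y : ℕ) < π x ∧ (π y : ℕ) < π z) :=
      fun x y z hxy hyz => by simpa only [natFun_val] using h.valley x y z hxy hyz z.2
    have ha : ∀ x y z : Fin n, x < y → y < z →
        ¬((π (π z) : ℕ) < π (π x) ∧ (π (π x) : ℕ) < π (π y)) :=
      fun x y z hxy hyz => by simpa only [natFun_val] using h.avoid x y z hxy hyz z.2
    refine ⟨?_, ?_, ?_⟩
    · rintro x y z ⟨hxy, hyz, h1, h2, h3⟩
      have := hv x y z hxy hyz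
      have := hne x y hxy
      omega
    · rintro x y z ⟨hxy, hyz, h1, h2, h3⟩
      have := hv x y z hxy hyz
      have := hne x y hxy
      omega
    · rintro x y z ⟨hxy, hyz, h1, h2, h3⟩
      have := ha x y z hxy hyz
      have := hne2 x z (hxy.trans hyz)
      omega
  · rintro ⟨h213, h312, h231⟩
    refine isGood_natFun π ?_ ?_
    · intro x y z hxy hyz hz
      lift z to Fin n using hz
      lift y to Fin n using hyz.trans z.2
      lift x to Fin n using hxy.trans y.2
      simp only [natFun_val]
      rintro ⟨h1, h2⟩
      have hxz := hne x z (Fin.lt_def.mpr (hxy.trans hyz))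
      rcases Nat.lt_or_gt_of_ne hxz with h3 | h3
      · exact h213 x y z ⟨hxy, hyz, by omega, by omega,
          by omega⟩
      · exact h312 x y z ⟨hxy, hyz, by omega, by omega,
          by omega⟩
    · intro x y z hxy hyz hz
      lift z to Fin n using hz
      lift y to Fin n using hyz.trans z.2
      lift x to Fin n using hxy.trans y.2
      simp only [natFun_val]
      rintro ⟨h1, h2⟩
      exact h231 x y z ⟨hxy, hyz, by omega, by omega,
        by omega⟩

theorem stmt3 (n : ℕ) (hn : 1 ≤ n) :
    Nat.card {π : Equiv.Perm (Fin n) //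
      PermAvoids π p213 ∧ PermAvoids π p312 ∧ PermAvoids (π ^ 2) p231} =
      (n * (n + 1) + 2) / 3 := by
  have hmem : ∀ p ∈ params n, n - 1 - p.1 < n ∧ p.2 < n - (n - 1 - p.1) ∧
      n - (n - 1 - p.1) - 1 ≤ 3 * p.2 ∧ p.1 < n := by
    intro p hp
    simp only [params, Finset.mem_sigma, Finset.mem_range, Finset.mem_Ico] at hp
    omega
  let F (p : params n) : Equiv.Perm (Fin n) :=
    permOfNat (shiftedModel n (n - 1 - p.1.1) p.1.2)
      (fun x hx => by
        obtain ⟨h1, h2, h3, -⟩ := hmem _ p.2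
        exact (shiftedModel_properties (y := 0) (z := 0) h1 h2 h3).1 hx)
      (fun x hx y hy => by
        obtain ⟨h1, h2, h3, -⟩ := hmem _ p.2
        exact (shiftedModel_properties (z := 0) h1 h2 h3).2.1 hx hy)
  have hF : ∀ p : params n, ∀ x < n,
      natFun (F p) x = shiftedModel n (n - 1 - p.1.1) p.1.2 x :=
    fun p x hx => natFun_permOfNat _ _ _ hx
  have hgood : ∀ p : params n, IsGood n (natFun (F p)) := by
    intro p
    obtain ⟨h1, h2, h3, -⟩ := hmem _ p.2
    have haux := fun x y z => shiftedModel_properties (x := x) (y := y) (z := z) h1 h2 h3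
    have hmaps := fun x hx => (haux x 0 0).1 hx
    refine isGood_natFun _ (fun x y z hxy hyz hz => ?_) (fun x y z hxy hyz hz => ?_)
    · rw [hF p x (by omega), hF p y (by omega), hF p z hz]
      exact (haux x y z).2.2.1 hxy hyz hz
    · rw [hF p x (by omega), hF p y (by omega), hF p z hz, hF p _ (hmaps x (by omega)),
        hF p _ (hmaps y (by omega)), hF p _ (hmaps z hz)]
      exact (haux x y z).2.2.2 hxy hyz hz
  let G (p : params n) : {π : Equiv.Perm (Fin n) //
      PermAvoids π p213 ∧ PermAvoids π p312 ∧ PermAvoids (π ^ 2) p231} :=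
    ⟨F p, (isGood_natFun_iff _).mp (hgood p)⟩
  have hG : Function.Bijective G := by
    constructor
    · intro p q hpq
      have hFF : F p = F q := congrArg Subtype.val hpq
      obtain ⟨p1, p2, p3, p4⟩ := hmem _ p.2
      obtain ⟨q1, q2, q3, q4⟩ := hmem _ q.2
      have hc := hF p (n - 1) (by omega)
      rw [hFF, hF q _ (by omega), shiftedModel_last p1 p3, shiftedModel_last q1 q3] at hc
      have ht := hF p _ p1
      rw [hFF, hF q _ p1, shiftedModel_first p2 p3, ← hc, shiftedModel_first q2 q3] at ht
      exact Subtype.ext (Sigma.ext (by omega) (heq_of_eq (by omega)))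
    · rintro ⟨π, hπ⟩
      obtain ⟨c, t, hc, ht, hct, heq⟩ := ((isGood_natFun_iff π).mpr hπ).eq_shiftedModel hn
      refine ⟨⟨⟨n - 1 - c, t⟩, ?_⟩, Subtype.ext (Equiv.ext fun x => Fin.ext ?_)⟩
      · simp only [params, Finset.mem_sigma, Finset.mem_range, Finset.mem_Ico]
        omega
      · rw [← natFun_val, ← natFun_val, heq x x.2]
        refine (hF _ x x.2).trans ?_
        rw [show n - 1 - (n - 1 - c) = c by omega]
  rw [← Nat.card_congr (Equiv.ofBijective G hG), Nat.card_eq_fintype_card, Fintype.card_coe,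
    card_params]
end

section
/- For every integer n ≥ 3, the number of permutations π in S_n such that π avoids both of the patterns 213 and 312 and π² avoids the pattern 321 equals ⌊(n+3)²/4⌋ − 5. -/
/-- `π` is unimodal (equivalently, it avoids 213 and 312) and its square avoids 321. -/
def UnimodalSqAvoids {n : ℕ} (π : Equiv.Perm (Fin n)) : Prop :=
  (∀ i j k, i < j → j < k → ¬ (π j < π i ∧ π j < π k)) ∧
    ∀ i j k, i < j → j < k → ¬ (π (π k) < π (π j) ∧ π (π j) < π (π i))

theorem permContains_three_iff {n : ℕ} (π : Equiv.Perm (Fin n)) (τ : Equiv.Perm (Fin 3)) :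
    PermContains π τ ↔ ∃ i j k, i < j ∧ j < k ∧
      ∀ a b : Fin 3, τ a < τ b ↔ π (![i, j, k] a) < π (![i, j, k] b) := by
  constructor
  · rintro ⟨f, hf, h⟩
    have e : ![f 0, f 1, f 2] = f := by
      ext a; fin_cases a <;> rfl
    exact ⟨f 0, f 1, f 2, hf (by decide), hf (by decide), by rw [e]; exact h⟩
  · rintro ⟨i, j, k, hij, hjk, h⟩
    refine ⟨![i, j, k], ?_, h⟩
    intro a b hab
    fin_cases a <;> fin_cases b <;> simp_all
    exact hij.trans hjk

theorem unimodalSqAvoids_iff {n : ℕ} (π : Equiv.Perm (Fin n)) :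
    (PermAvoids π p213 ∧ PermAvoids π p312 ∧ PermAvoids (π ^ 2) p321) ↔
      UnimodalSqAvoids π := by
  simp only [PermAvoids, permContains_three_iff, UnimodalSqAvoids, Fin.forall_fin_succ,
    p213, p312, p321, pow_two, Equiv.Perm.mul_apply]
  simp
  constructor
  · rintro ⟨h1, h2, h3⟩
    constructor
    · intro i j k hij hjk hji
      by_contra! hlt
      have := h1 i j hij k hjk
      have := h2 i j hij k hjk
      have : π i ≠ π k := π.injective.ne (hij.trans hjk).ne
      grind
    · intro i j k hij hjk h
      have := h3 i j hij k hjk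
      grind
  · rintro ⟨h1, h2⟩
    refine ⟨fun i j hij k hjk => ?_, fun i j hij k hjk => ?_, fun i j hij k hjk => ?_⟩
    · have := h1 i j k hij hjk
      grind
    · have := h1 i j k hij hjk
      grind
    · have := h2 i j k hij hjk
      grind

/-- The permutation fixing `0` and acting as `π` on the remaining points. -/
def liftPerm {n : ℕ} (π : Equiv.Perm (Fin n)) : Equiv.Perm (Fin (n + 1)) :=
  Equiv.Perm.decomposeFin.symm (0, π)

@[simp] theorem liftPerm_zero {n : ℕ} (π : Equiv.Perm (Fin n)) : liftPerm π 0 = 0 := by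
  simp [liftPerm]

@[simp] theorem liftPerm_succ {n : ℕ} (π : Equiv.Perm (Fin n)) (i : Fin n) :
    liftPerm π i.succ = (π i).succ := by
  simp [liftPerm]

theorem liftPerm_injective {n : ℕ} : Function.Injective (liftPerm (n := n)) := by
  intro π ρ h
  ext i
  have := congrArg (fun σ => σ i.succ) h
  simpa [Fin.ext_iff] using this

theorem exists_liftPerm_eq {n : ℕ} (π : Equiv.Perm (Fin (n + 1))) (h : π 0 = 0) :
    ∃ ρ, liftPerm ρ = π := by
  obtain ⟨⟨a, ρ⟩, rfl⟩ := Equiv.Perm.decomposeFin.symm.surjective π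
  have ha : a = 0 := by simpa using h
  subst ha
  exact ⟨ρ, rfl⟩

theorem unimodalSqAvoids_liftPerm {n : ℕ} (π : Equiv.Perm (Fin n)) :
    UnimodalSqAvoids (liftPerm π) ↔ UnimodalSqAvoids π := by
  simp [UnimodalSqAvoids, Fin.forall_fin_succ]

section Sequences

variable {N : ℕ} {p : ℕ → ℕ}

/-- `p` restricts to a bijection of `{0, …, N}` sending `N` to `0`, has no valley there, and
its square has no decreasing subsequence of length three. -/
structure UnimodalSeq (N : ℕ) (p : ℕ → ℕ) : Prop where
  le : ∀ i ≤ N, p i ≤ N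
  inj : ∀ i ≤ N, ∀ j ≤ N, p i = p j → i = j
  surj : ∀ j ≤ N, ∃ i ≤ N, p i = j
  no_valley : ∀ i j k, i < j → j < k → k ≤ N → p j < p i → p j < p k → False
  sq_avoids : ∀ i j k, i < j → j < k → k ≤ N → p (p k) < p (p j) → p (p j) < p (p i) → False
  last : p N = 0

/-- The values of `p` when it is a cyclic shift. -/
def shiftSeq (N i : ℕ) : ℕ := if i = N then 0 else i + 1

/-- The sequence starting with `v` followed by the other elements of `{0, …, N}`
in decreasing order. -/
def revSeq (N v i : ℕ) : ℕ := if i = 0 then v else if i + v ≤ N then N + 1 - i else N - i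

/-- The only admissible sequence starting with `v`. -/
def admissibleSeq (N v i : ℕ) : ℕ := if v = 1 then shiftSeq N i else revSeq N v i

namespace UnimodalSeq

theorem lt_of_le_peak (h : UnimodalSeq N p) {k : ℕ} (hk : k ≤ N) (hpk : p k = N)
    {i j : ℕ} (hij : i < j) (hj : j ≤ k) : p i < p j := by
  have h1 := h.inj i (by omega) j (by omega)
  rcases hj.eq_or_lt with rfl | hj
  · have := h.le i (by omega); grind
  · have h2 := h.no_valley i j k hij hj hk
    have := h.le j (by omega)
    have h3 := h.inj j (by omega) k hk
    grind

theorem lt_of_peak_le (h : UnimodalSeq N p) {k : ℕ} (hpk : p k = N)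
    {i j : ℕ} (hk : k ≤ i) (hij : i < j) (hj : j ≤ N) : p j < p i := by
  have h1 := h.inj i (by omega) j (by omega)
  rcases hk.eq_or_lt with rfl | hk
  · have := h.le j (by omega); grind
  · have h2 := h.no_valley k i j hk hij hj
    have := h.le i (by omega)
    have h3 := h.inj i (by omega) k (by omega)
    grind

theorem eq_revSeq (h : UnimodalSeq N p) (hN : 1 ≤ N)
    (hanti : ∀ i j, 1 ≤ i → i < j → j ≤ N → p j < p i) :
    ∀ i ≤ N, p i = revSeq N (p 0) i := by
  have hv : 1 ≤ p 0 := by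
    have := h.inj 0 (by omega) N le_rfl
    have := h.last
    grind
  have hv' := h.le 0 (by omega)
  have upper : ∀ i, 1 ≤ i → i ≤ N → p i ≤ N + 1 - i := by
    intro i hi
    induction i, hi using Nat.le_induction with
    | base => intro _; have := h.le 1 (by omega); omega
    | succ i hi ih =>
      intro hiN
      have := hanti i (i + 1) hi (by omega) hiN
      have := ih (by omega)
      omega
  have lower : ∀ d, d < N → d ≤ p (N - d) := by
    intro d
    induction d with
    | zero => omega
    | succ d ih =>
      intro hd
      have := hanti (N - (d + 1)) (N - d) (by omega) (by omega) (by omega)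
      have := ih (by omega)
      omega
  have lower' : ∀ i, 1 ≤ i → i ≤ N → N - i ≤ p i := by
    intro i hi hiN
    have := lower (N - i) (by omega)
    rwa [Nat.sub_sub_self hiN] at this
  have big : ∀ i, 1 ≤ i → i + p 0 ≤ N → p i = N + 1 - i := by
    intro i hi
    induction i, hi using Nat.le_induction with
    | base =>
      intro hiN
      obtain ⟨j, hj, hpj⟩ := h.surj N le_rfl
      have hj0 : j ≠ 0 := by rintro rfl; omega
      have := upper j (by omega) hj
      have : j = 1 := by omega
      subst this; omega
    | succ i hi ih =>
      intro hiN
      obtain ⟨j, hj, hpj⟩ := h.surj (N - i) (by omega)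
      have hj0 : j ≠ 0 := by rintro rfl; omega
      have := upper j (by omega) hj
      have := lower' j (by omega) hj
      have hji : j ≠ i := by rintro rfl; have := ih (by omega); omega
      have : j = i + 1 := by omega
      subst this; omega
  have small : ∀ d, d < N → d < p 0 → p (N - d) = d := by
    intro d
    induction d with
    | zero => intro _ _; exact h.last
    | succ d ih =>
      intro hd hdv
      obtain ⟨j, hj, hpj⟩ := h.surj (d + 1) (by omega)
      have hj0 : j ≠ 0 := by rintro rfl; omega
      have := upper j (by omega) hj
      have := lower' j (by omega) hj
      have hji : j ≠ N - d := by rintro rfl; have := ih (by omega) (by omega); omega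
      have : j = N - (d + 1) := by omega
      subst this; omega
  intro i hi
  unfold revSeq
  split_ifs with h0 h1
  · rw [h0]
  · exact big i (by omega) h1
  · have := small (N - i) (by omega) (by omega)
    rwa [Nat.sub_sub_self hi] at this

theorem le_two_mul_of_eq_revSeq (h : UnimodalSeq N p) (hN : 1 ≤ N)
    (hp : ∀ i ≤ N, p i = revSeq N (p 0) i) : N ≤ 2 * p 0 := by
  by_contra! hlt
  have hv : 1 ≤ p 0 := by
    have := h.inj 0 (by omega) N le_rfl
    have := h.last
    grind
  have h0 : p (p 0) = N + 1 - p 0 := by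
    rw [hp (p 0) (by omega), revSeq, if_neg (by omega), if_pos (by omega)]
  obtain ⟨b, hb, hpb⟩ := h.surj (p 0 + 1) (by omega)
  obtain ⟨a, ha, rfl⟩ := h.surj b hb
  have ha0 : a ≠ 0 := by rintro rfl; omega
  have haN : a ≠ N := by rintro rfl; rw [h.last] at hpb; omega
  exact h.sq_avoids 0 a N (by omega) (by omega) le_rfl (by rw [h.last]; omega) (by omega)

theorem eq_shiftSeq (h : UnimodalSeq N p) {k : ℕ} (hk : 2 ≤ k) (hkN : k ≤ N) (hpk : p k = N) :
    ∀ i ≤ N, p i = shiftSeq N i := by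
  have hlast := h.last
  have hkN' : k < N := by
    rcases hkN.eq_or_lt with rfl | hlt
    · omega
    · exact hlt
  have hσk : p (p k) = 0 := by rw [hpk, hlast]
  have σinj : ∀ i ≤ N, ∀ j ≤ N, p (p i) = p (p j) → i = j := fun i hi j hj hij =>
    h.inj i hi j hj (h.inj _ (h.le i hi) _ (h.le j hj) hij)
  have σmono : ∀ i j, i < j → j < k → p (p i) < p (p j) := by
    intro i j hij hjk
    have h1 := h.sq_avoids i j k hij hjk hkN
    have h2 := σinj i (by omega) j (by omega)
    have h3 := σinj j (by omega) k (by omega)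
    grind
  have lower : ∀ i, i ≤ k → i + 1 ≤ p i := by
    intro i
    induction i with
    | zero =>
      intro _
      have := h.inj 0 (by omega) N le_rfl
      grind
    | succ i ih =>
      intro hi
      have := h.lt_of_le_peak hkN hpk (i := i) (j := i + 1) (by omega) hi
      have := ih (by omega)
      omega
  have hk2 : p (k - 2) ≤ k - 1 := by
    by_contra! hlt
    have h1 := σmono (k - 2) (k - 1) (by omega) (by omega)
    have h2 := h.lt_of_le_peak hkN hpk (i := k - 2) (j := k - 1) (by omega) (by omega)
    have h3 := h.lt_of_peak_le hpk (i := p (k - 2)) (j := p (k - 1)) (by omega) h2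
      (h.le _ (by omega))
    omega
  have upper : ∀ d, d + 2 ≤ k → p (k - 2 - d) ≤ k - 1 - d := by
    intro d
    induction d with
    | zero => intro _; simpa using hk2
    | succ d ih =>
      intro hd
      have := h.lt_of_le_peak hkN hpk (i := k - 2 - (d + 1)) (j := k - 2 - d)
        (by omega) (by omega)
      have := ih (by omega)
      omega
  have left : ∀ i, i + 2 ≤ k → p i = i + 1 := by
    intro i hi
    have h1 := upper (k - 2 - i) (by omega)
    have h2 := lower i (by omega)
    rw [show k - 2 - (k - 2 - i) = i by omega] at h1
    omega
  have hσN : p (p N) = 1 := by rw [hlast]; simpa using left 0 (by omega)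
  have σmono' : ∀ i j, i < j → j < N → i ≠ k → j ≠ k → p (p i) < p (p j) := by
    intro i j hij hjN hik hjk
    have h1 := h.sq_avoids i j N hij hjN le_rfl
    have h2 := σinj i (by omega) j (by omega)
    have h3 := σinj j (by omega) k (by omega)
    have h4 := σinj j (by omega) N (by omega)
    grind
  have hσk2 : p (p (k - 2)) = p (k - 1) := by
    rw [left (k - 2) (by omega)]; congr 1; omega
  have hσle : ∀ i ≤ N, p (p i) ≤ N := fun i hi => h.le _ (h.le i hi)
  have hv : p (k - 1) = k := by
    by_contra hne
    have h1 := lower (k - 1) (by omega)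
    have h2 := σmono (k - 2) (k - 1) (by omega) (by omega)
    have grow : ∀ i, k + 1 ≤ i → i < N → i + 2 ≤ p (p i) := by
      intro i hi
      induction i, hi using Nat.le_induction with
      | base =>
        intro hi
        have := σmono' (k - 1) (k + 1) (by omega) hi (by omega) (by omega)
        omega
      | succ i hi ih =>
        intro hi'
        have := σmono' i (i + 1) (by omega) hi' (by omega) (by omega)
        have := ih (by omega)
        omega
    rcases (show k + 1 ≤ N from hkN').eq_or_lt with heq | hlt
    · have := hσle (k - 1) (by omega)
      omega
    · have := grow (N - 1) (by omega) (by omega)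
      have := hσle (N - 1) (by omega)
      omega
  have hkN1 : k + 1 = N := by
    by_contra hne
    have h1 := σmono' (k - 1) (k + 1) (by omega) (by omega) (by omega) (by omega)
    have h2 := hσle (k + 1) (by omega)
    rw [hv, hpk] at h1
    omega
  intro i hi
  unfold shiftSeq
  split_ifs with hiN
  · rw [hiN, hlast]
  · rcases (show i + 2 ≤ k ∨ i = k - 1 ∨ i = k by omega) with hi | rfl | rfl
    · exact left i hi
    · omega
    · omega

theorem eq_admissibleSeq (h : UnimodalSeq N p) (hN : 2 ≤ N) :
    (N ≤ 2 * p 0 ∨ p 0 = 1) ∧ ∀ i ≤ N, p i = admissibleSeq N (p 0) i := by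
  obtain ⟨k, hk, hpk⟩ := h.surj N le_rfl
  rcases Nat.lt_or_ge k 2 with hk2 | hk2
  · have hr := h.eq_revSeq (by omega) fun i j hi hij hj =>
      h.lt_of_peak_le hpk (by omega) hij hj
    have hv := h.le_two_mul_of_eq_revSeq (by omega) hr
    refine ⟨Or.inl hv, fun i hi => ?_⟩
    rw [hr i hi]
    simp only [revSeq, admissibleSeq, shiftSeq]
    split_ifs <;> omega
  · have hs := h.eq_shiftSeq hk2 hk hpk
    have h0 : p 0 = 1 := by
      rw [hs 0 (by omega), shiftSeq, if_neg (by omega)]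
    refine ⟨Or.inr h0, fun i hi => ?_⟩
    rw [hs i hi, admissibleSeq, if_pos h0]

end UnimodalSeq

theorem admissibleSeq_le {v : ℕ} (hN : 2 ≤ N) (hv : v ≤ N) {i : ℕ} (hi : i ≤ N) :
    admissibleSeq N v i ≤ N := by
  simp only [revSeq, admissibleSeq, shiftSeq]
  split_ifs <;> omega

theorem admissibleSeq_inj {v : ℕ} (hv : v ≤ N) {i j : ℕ} (hi : i ≤ N)
    (hj : j ≤ N) (h : admissibleSeq N v i = admissibleSeq N v j) : i = j := by
  simp only [revSeq, admissibleSeq, shiftSeq] at h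
  split_ifs at h <;> omega

theorem admissibleSeq_zero {v : ℕ} (hN : 2 ≤ N) : admissibleSeq N v 0 = v := by
  simp only [revSeq, admissibleSeq, shiftSeq]
  split_ifs <;> omega

theorem admissibleSeq_last {v : ℕ} (hN : 2 ≤ N) (hv : N ≤ 2 * v ∨ v = 1) :
    admissibleSeq N v N = 0 := by
  simp only [revSeq, admissibleSeq, shiftSeq]
  split_ifs <;> omega

theorem admissibleSeq_no_valley {v : ℕ} {i j k : ℕ} (hij : i < j)
    (hjk : j < k) (hk : k ≤ N) (h1 : admissibleSeq N v j < admissibleSeq N v i)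
    (h2 : admissibleSeq N v j < admissibleSeq N v k) : False := by
  simp only [revSeq, admissibleSeq, shiftSeq] at h1 h2
  split_ifs at h1 h2 <;> omega

theorem shiftSeq_sq (hN : 2 ≤ N) {i : ℕ} (hi : i ≤ N) :
    shiftSeq N (shiftSeq N i) = if i + 2 ≤ N then i + 2 else i + 1 - N := by
  simp only [shiftSeq]
  split_ifs <;> omega

theorem revSeq_sq_last {v : ℕ} (hv : N ≤ 2 * v) (hN : 2 ≤ N) :
    revSeq N v (revSeq N v N) = v := by
  simp only [revSeq]
  split_ifs <;> omega

theorem revSeq_sq_zero_le {v : ℕ} (hv : N ≤ 2 * v) : revSeq N v (revSeq N v 0) ≤ v + 1 := by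
  simp only [revSeq]
  split_ifs <;> omega

theorem revSeq_sq_lt {v : ℕ} (hv : N ≤ 2 * v) {i j : ℕ} (hi : 0 < i)
    (hij : i < j) (hj : j < N) : revSeq N v (revSeq N v i) < revSeq N v (revSeq N v j) := by
  have key : ∀ i, 0 < i → i < N → revSeq N v (revSeq N v i) =
      if i + v ≤ N then i - 1 else if i < v then i else i + 1 := by
    intro i hi hiN
    simp only [revSeq]
    split_ifs <;> omega
  rw [key i hi (by omega), key j (by omega) hj]
  split_ifs <;> omega

theorem admissibleSeq_sq_avoids {v : ℕ} (hN : 2 ≤ N) (hv : N ≤ 2 * v ∨ v = 1)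
    {i j k : ℕ} (hij : i < j) (hjk : j < k) (hk : k ≤ N)
    (h1 : admissibleSeq N v (admissibleSeq N v k) < admissibleSeq N v (admissibleSeq N v j))
    (h2 : admissibleSeq N v (admissibleSeq N v j) < admissibleSeq N v (admissibleSeq N v i)) :
    False := by
  by_cases hv1 : v = 1
  · simp only [admissibleSeq, if_pos hv1] at h1 h2
    rw [shiftSeq_sq hN (by omega), shiftSeq_sq hN (by omega)] at h1 h2
    split_ifs at h1 h2 <;> omega
  · have hv2 : N ≤ 2 * v := by omega
    simp only [admissibleSeq, if_neg hv1] at h1 h2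
    have hi : i = 0 := by
      by_contra hi
      have := revSeq_sq_lt hv2 (i := i) (j := j) (by omega) hij (by omega)
      omega
    have hkN : k = N := by
      by_contra hkN
      have := revSeq_sq_lt hv2 (i := j) (j := k) (by omega) hjk (by omega)
      omega
    subst hi hkN
    have := revSeq_sq_last hv2 hN
    have := revSeq_sq_zero_le hv2
    omega

end Sequences

/-- The sequence of values of a permutation, extended by `0`. -/
def permSeq {N : ℕ} (π : Equiv.Perm (Fin (N + 1))) (i : ℕ) : ℕ :=
  if h : i < N + 1 then π ⟨i, h⟩ else 0

theorem permSeq_val {N : ℕ} (π : Equiv.Perm (Fin (N + 1))) (i : Fin (N + 1)) :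
    permSeq π i = π i := by
  rw [permSeq, dif_pos i.isLt]

theorem unimodalSeq_permSeq {N : ℕ} {π : Equiv.Perm (Fin (N + 1))} (h : UnimodalSqAvoids π)
    (hlast : π (Fin.last N) = 0) : UnimodalSeq N (permSeq π) := by
  have key : ∀ i ≤ N, ∃ a : Fin (N + 1), (a : ℕ) = i := fun i hi => ⟨⟨i, by omega⟩, rfl⟩
  refine ⟨?_, ?_, ?_, ?_, ?_, ?_⟩
  · intro i hi
    obtain ⟨a, rfl⟩ := key i hi
    rw [permSeq_val]; omega
  · intro i hi j hj hij
    obtain ⟨a, rfl⟩ := key i hi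
    obtain ⟨b, rfl⟩ := key j hj
    rw [permSeq_val, permSeq_val, Fin.val_inj, π.apply_eq_iff_eq] at hij
    rw [hij]
  · intro j hj
    obtain ⟨b, rfl⟩ := key j hj
    exact ⟨π.symm b, by omega, by rw [permSeq_val]; simp⟩
  · intro i j k hij hjk hk h1 h2
    obtain ⟨a, rfl⟩ := key i (by omega)
    obtain ⟨b, rfl⟩ := key j (by omega)
    obtain ⟨c, rfl⟩ := key k (by omega)
    simp only [permSeq_val, Fin.val_fin_lt] at *
    exact h.1 a b c hij hjk ⟨h1, h2⟩
  · intro i j k hij hjk hk h1 h2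
    obtain ⟨a, rfl⟩ := key i (by omega)
    obtain ⟨b, rfl⟩ := key j (by omega)
    obtain ⟨c, rfl⟩ := key k (by omega)
    simp only [permSeq_val, Fin.val_fin_lt] at *
    exact h.2 a b c hij hjk ⟨h1, h2⟩
  · have := permSeq_val π (Fin.last N)
    rw [hlast] at this
    simpa using this

theorem exists_perm_eq_admissibleSeq {N v : ℕ} (hN : 2 ≤ N) (hvN : v ≤ N) :
    ∃ π : Equiv.Perm (Fin (N + 1)), ∀ i, (π i : ℕ) = admissibleSeq N v i := by
  let f : Fin (N + 1) → Fin (N + 1) := fun i =>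
    ⟨admissibleSeq N v i, Nat.lt_succ_of_le (admissibleSeq_le hN hvN (by omega))⟩
  have hf : Function.Injective f := fun i j hij =>
    Fin.ext (admissibleSeq_inj hvN (by omega) (by omega) (congrArg Fin.val hij))
  exact ⟨Equiv.ofBijective f (Finite.injective_iff_bijective.mp hf), fun i => rfl⟩

theorem ncard_unimodalSqAvoids_last_eq_zero {N : ℕ} (hN : 2 ≤ N) :
    {π : Equiv.Perm (Fin (N + 1)) | UnimodalSqAvoids π ∧ π (Fin.last N) = 0}.ncard =
      (insert 1 (Finset.Icc ((N + 1) / 2) N)).card := by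
  rw [← Set.ncard_coe_finset]
  refine Set.ncard_congr (fun π _ => (π 0 : ℕ)) ?_ ?_ ?_
  · rintro π ⟨h, hlast⟩
    have := ((unimodalSeq_permSeq h hlast).eq_admissibleSeq hN).1
    have h0 := permSeq_val π 0
    simp only [Fin.val_zero] at h0
    simp only [Finset.coe_insert, Finset.coe_Icc, Set.mem_insert_iff, Set.mem_Icc]
    omega
  · rintro π ρ ⟨h, hlast⟩ ⟨h', hlast'⟩ h0
    have e := ((unimodalSeq_permSeq h hlast).eq_admissibleSeq hN).2
    have e' := ((unimodalSeq_permSeq h' hlast').eq_admissibleSeq hN).2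
    have z := permSeq_val π 0
    have z' := permSeq_val ρ 0
    simp only [Fin.val_zero] at z z'
    ext i
    rw [← permSeq_val, ← permSeq_val, e i (by omega), e' i (by omega), z, z', h0]
  · intro v hv
    simp only [Finset.coe_insert, Finset.coe_Icc, Set.mem_insert_iff, Set.mem_Icc] at hv
    have hv' : N ≤ 2 * v ∨ v = 1 := by omega
    obtain ⟨π, hπ⟩ := exists_perm_eq_admissibleSeq hN (show v ≤ N by omega)
    refine ⟨π, ⟨⟨?_, ?_⟩, ?_⟩, ?_⟩
    · rintro i j k hij hjk ⟨h1, h2⟩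
      rw [Fin.lt_def] at *
      rw [hπ, hπ] at h1 h2
      exact admissibleSeq_no_valley hij hjk (by omega) h1 h2
    · rintro i j k hij hjk ⟨h1, h2⟩
      rw [Fin.lt_def] at *
      simp only [hπ] at h1 h2
      exact admissibleSeq_sq_avoids hN hv' hij hjk (by omega) h1 h2
    · apply Fin.ext
      rw [hπ]
      exact admissibleSeq_last hN hv'
    · rw [hπ]
      exact admissibleSeq_zero hN

theorem ncard_unimodalSqAvoids_succ {N : ℕ} (hN : 2 ≤ N) :
    {π : Equiv.Perm (Fin (N + 1)) | UnimodalSqAvoids π}.ncard =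
      {π : Equiv.Perm (Fin N) | UnimodalSqAvoids π}.ncard +
        (insert 1 (Finset.Icc ((N + 1) / 2) N)).card := by
  have hlift : liftPerm '' {π : Equiv.Perm (Fin N) | UnimodalSqAvoids π} =
      {π | UnimodalSqAvoids π ∧ π 0 = 0} := by
    ext π
    constructor
    · rintro ⟨ρ, hρ, rfl⟩
      exact ⟨(unimodalSqAvoids_liftPerm ρ).mpr hρ, liftPerm_zero ρ⟩
    · rintro ⟨h, h0⟩
      obtain ⟨ρ, rfl⟩ := exists_liftPerm_eq π h0
      exact ⟨ρ, (unimodalSqAvoids_liftPerm ρ).mp h, rfl⟩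
  rw [← ncard_unimodalSqAvoids_last_eq_zero hN,
    ← Set.ncard_image_of_injective {π : Equiv.Perm (Fin N) | UnimodalSqAvoids π} liftPerm_injective,
    hlift, ← Set.ncard_union_eq]
  · congr 1
    ext π
    simp only [Set.mem_ofPred_eq, Set.mem_union, ← and_or_left, iff_self_and]
    intro h
    by_contra! hne
    obtain ⟨a, ha⟩ := π.surjective 0
    have ha0 : a ≠ 0 := by rintro rfl; exact hne.1 ha
    have haN : a ≠ Fin.last N := by rintro rfl; exact hne.2 ha
    refine h.1 0 a (Fin.last N) (Fin.pos_iff_ne_zero.mpr ha0) (Fin.lt_last_iff_ne_last.mpr haN) ?_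
    rw [ha]
    exact ⟨Fin.pos_iff_ne_zero.mpr hne.1, Fin.pos_iff_ne_zero.mpr hne.2⟩
  · rw [Set.disjoint_left]
    rintro π ⟨_, h0⟩ ⟨_, h1⟩
    have := π.injective (h0.trans h1.symm)
    simp only [Fin.ext_iff, Fin.val_zero, Fin.val_last] at this
    omega

theorem ncard_unimodalSqAvoids_two :
    {π : Equiv.Perm (Fin 2) | UnimodalSqAvoids π}.ncard = 2 := by
  have : {π : Equiv.Perm (Fin 2) | UnimodalSqAvoids π} = Set.univ := by
    refine Set.eq_univ_of_forall fun π => ⟨?_, ?_⟩ <;> intro i j k hij hjk <;> omega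
  rw [this, Set.ncard_univ, Nat.card_eq_fintype_card, Fintype.card_perm]
  rfl

theorem ncard_unimodalSqAvoids {n : ℕ} (hn : 3 ≤ n) :
    {π : Equiv.Perm (Fin n) | UnimodalSqAvoids π}.ncard = (n + 3) ^ 2 / 4 - 5 := by
  induction n, hn using Nat.le_induction with
  | base =>
    rw [ncard_unimodalSqAvoids_succ le_rfl, ncard_unimodalSqAvoids_two]
    decide
  | succ n hn ih =>
    rw [ncard_unimodalSqAvoids_succ (by omega), ih, Finset.card_insert_of_notMem
      (by rw [Finset.mem_Icc]; omega), Nat.card_Icc]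
    obtain ⟨k, rfl | rfl⟩ := n.even_or_odd'
    · ring_nf; omega
    · ring_nf; omega

theorem stmt5 (n : ℕ) (hn : 3 ≤ n) :
    Nat.card {π : Equiv.Perm (Fin n) //
      PermAvoids π p213 ∧ PermAvoids π p312 ∧ PermAvoids (π ^ 2) p321} =
      (n + 3) ^ 2 / 4 - 5 := by
  simp only [unimodalSqAvoids_iff]
  exact ncard_unimodalSqAvoids hn
end

section
/- For every integer n ≥ 8, the number of permutations π in S_n such that π avoids the pattern 312 and π² avoids the pattern 123 is at least ⌊n/2⌋. -/
/-- For `b = min p (n / 2)`, the word whose first `b` entries are `n - 1 - b, …, n - 2` and whose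
remaining entries decrease, except that the largest value `n - 1` is inserted at position `p`. -/
def peakWord (n p i : ℕ) : ℕ :=
  if i < min p (n / 2) then n - 1 - min p (n / 2) + i
  else if i < p then n - 2 - i
  else if i = p then n - 1
  else n - 1 - i

theorem peakWord_lt {n p i : ℕ} (hn : 2 ≤ n) (hp : p + 2 ≤ n) (hi : i < n) :
    peakWord n p i < n := by
  unfold peakWord
  split_ifs <;> omega

theorem peakWord_injOn {n p i j : ℕ} (hn : 2 ≤ n) (hp : p + 2 ≤ n) (hi : i < n) (hj : j < n)
    (h : peakWord n p i = peakWord n p j) : i = j := by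
  unfold peakWord at h
  split_ifs at h <;> omega

theorem peakWord_avoids_312 {n p i j k : ℕ} (hp : p + 2 ≤ n) (hk : k < n) (hij : i < j)
    (hjk : j < k) (h₁ : peakWord n p j < peakWord n p k)
    (h₂ : peakWord n p k < peakWord n p i) : False := by
  unfold peakWord at h₁ h₂
  generalize min p (n / 2) = b at *
  rcases lt_or_ge k b with hkb | hkb
  · rw [if_pos hkb] at h₁ h₂
    split_ifs at h₁ h₂ <;> omega
  rw [if_neg (by omega : ¬ k < b)] at h₁ h₂
  split_ifs at h₁ <;> split_ifs at h₂ <;> omega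

/-- Explicit values of the square of `peakWord n p`, where `b = min p (n / 2)`: it is decreasing
on `[0, b)` and on `[b, n)`, apart from a few exceptional entries. -/
theorem peakWord_sq_cases {n p b i : ℕ} (hp : p + 2 ≤ n) (hp' : n ≤ p + 1 + n / 2)
    (hb : b = min p (n / 2)) (hi : i < n) :
    (i = 0 ∧ 2 * b = n ∧ peakWord n p (peakWord n p i) = n - 2) ∨
    (i < b ∧ n - 1 - b + i < p ∧ peakWord n p (peakWord n p i) = b - 1 - i) ∨
    (i < b ∧ n - 1 - b + i = p ∧ peakWord n p (peakWord n p i) = n - 1) ∨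
    (i < b ∧ p < n - 1 - b + i ∧ peakWord n p (peakWord n p i) = b - i) ∨
    (b ≤ i ∧ i < p ∧ peakWord n p (peakWord n p i) = n - 1 - b + (n - 2 - i)) ∨
    (i = p ∧ peakWord n p (peakWord n p i) = 0) ∨
    (i = p + 1 ∧ p = b ∧ 2 * b + 2 = n ∧ peakWord n p (peakWord n p i) = n - 1) ∨
    (p < i ∧ peakWord n p (peakWord n p i) = n - 1 - b + (n - 1 - i)) := by
  have hb₁ : b ≤ p ∧ 2 * b ≤ n ∧ n ≤ 2 * b + 2 ∧ (n ≤ 2 * b + 1 ∨ b = p) := by omega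
  unfold peakWord
  rw [← hb]
  clear hb hp'
  obtain ⟨hbp, hbn, hnb, h⟩ := hb₁
  rcases lt_or_ge i b with hib | hib
  · rw [if_pos hib]
    rcases lt_or_ge (n - 1 - b + i) b with h' | h'
    · left
      rw [if_pos h']
      omega
    rw [if_neg (by omega : ¬ n - 1 - b + i < b)]
    rcases lt_trichotomy (n - 1 - b + i) p with hv | hv | hv
    · right; left
      rw [if_pos hv]
      omega
    · right; right; left
      rw [if_neg (by omega : ¬ n - 1 - b + i < p), if_pos hv]
      omega
    · right; right; right; left
      rw [if_neg (by omega : ¬ n - 1 - b + i < p), if_neg (by omega : ¬ n - 1 - b + i = p)]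
      omega
  rw [if_neg (by omega : ¬ i < b)]
  right; right; right; right
  rcases lt_trichotomy i p with hip | hip | hip
  · left
    rw [if_pos hip, if_pos (by omega : n - 2 - i < b)]
    omega
  · right; left
    rw [if_neg (by omega : ¬ i < p), if_pos hip, if_neg (by omega : ¬ n - 1 < b),
      if_neg (by omega : ¬ n - 1 < p), if_neg (by omega : ¬ n - 1 = p)]
    omega
  · right; right
    rw [if_neg (by omega : ¬ i < p), if_neg (by omega : ¬ i = p)]
    rcases lt_or_ge (n - 1 - i) b with h' | h'
    · right
      rw [if_pos h']
      omega
    · left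
      rw [if_neg (by omega : ¬ n - 1 - i < b), if_neg (by omega : ¬ n - 1 - i < p),
        if_pos (by omega : n - 1 - i = p)]
      omega

theorem peakWord_sq_avoids_123 {n p i j k : ℕ} (hn : 8 ≤ n) (hp : p + 2 ≤ n)
    (hp' : n ≤ p + 1 + n / 2) (hk : k < n) (hij : i < j) (hjk : j < k)
    (h₁ : peakWord n p (peakWord n p i) < peakWord n p (peakWord n p j))
    (h₂ : peakWord n p (peakWord n p j) < peakWord n p (peakWord n p k)) : False := by
  obtain ⟨b, hb⟩ : ∃ b, b = min p (n / 2) := ⟨_, rfl⟩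
  have hi := peakWord_sq_cases hp hp' hb (hij.trans (hjk.trans hk))
  have hj := peakWord_sq_cases hp hp' hb (hjk.trans hk)
  have hk' := peakWord_sq_cases hp hp' hb hk
  generalize peakWord n p (peakWord n p i) = u at *
  generalize peakWord n p (peakWord n p j) = v at *
  generalize peakWord n p (peakWord n p k) = w at *
  rcases hi with hi | hi | hi | hi | hi | hi | hi | hi <;>
  rcases hj with hj | hj | hj | hj | hj | hj | hj | hj <;>
  first
  | (clear hk'; omega)
  | (rcases hk' with h | h | h | h | h | h | h | h <;> omega)

/-- `peakWord` as a permutation. -/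
noncomputable def peakPerm (n p : ℕ) (hp : p + 2 ≤ n) : Equiv.Perm (Fin n) :=
  Equiv.ofBijective (fun i => ⟨peakWord n p i, peakWord_lt (by omega) hp i.2⟩)
    (Finite.injective_iff_bijective.mp fun i j h =>
      Fin.ext (peakWord_injOn (by omega) hp i.2 j.2 (congrArg Fin.val h)))

theorem peakPerm_avoids_312 (n p : ℕ) (hp : p + 2 ≤ n) : PermAvoids (peakPerm n p hp) p312 := by
  rintro ⟨f, hf, h⟩
  exact peakWord_avoids_312 hp (f 2).2 (hf (show (0 : Fin 3) < 1 by decide))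
    (hf (show (1 : Fin 3) < 2 by decide)) ((h 1 2).mp (by decide)) ((h 2 0).mp (by decide))

theorem peakPerm_sq_avoids_123 (n p : ℕ) (hn : 8 ≤ n) (hp : p + 2 ≤ n)
    (hp' : n ≤ p + 1 + n / 2) : PermAvoids (peakPerm n p hp ^ 2) p123 := by
  rintro ⟨f, hf, h⟩
  exact peakWord_sq_avoids_123 hn hp hp' (f 2).2 (hf (show (0 : Fin 3) < 1 by decide))
    (hf (show (1 : Fin 3) < 2 by decide)) ((h 0 1).mp (by decide)) ((h 1 2).mp (by decide))

theorem peakPerm_inj {n p q : ℕ} (hp : p + 2 ≤ n) (hq : q + 2 ≤ n)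
    (h : peakPerm n p hp = peakPerm n q hq) : p = q := by
  have h' : peakWord n p p = peakWord n q p :=
    congrArg Fin.val (DFunLike.congr_fun h (⟨p, by omega⟩ : Fin n))
  unfold peakWord at h'
  split_ifs at h' <;> omega

theorem stmt6 (n : ℕ) (hn : 8 ≤ n) :
    n / 2 ≤ Nat.card {π : Equiv.Perm (Fin n) //
      PermAvoids π p312 ∧ PermAvoids (π ^ 2) p123} := by
  let g : Fin (n / 2) → {π : Equiv.Perm (Fin n) //
      PermAvoids π p312 ∧ PermAvoids (π ^ 2) p123} := fun k =>
    ⟨peakPerm n (n - 2 - k) (by omega), peakPerm_avoids_312 _ _ _,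
      peakPerm_sq_avoids_123 _ _ hn _ (by omega)⟩
  have hg : Function.Injective g := fun k l h => by
    have := peakPerm_inj (p := n - 2 - k) (q := n - 2 - l) (by omega) (by omega)
      (congrArg Subtype.val h)
    omega
  simpa using Nat.card_le_card_of_injective g hg
end

section
/- For every integer n ≥ 3, the number of permutations π in S_n such that π avoids the pattern 312 and π² avoids the pattern 132 is at least 2^{n−1}. -/
/-- The first position of the block containing `i`, where the blocks are the maximal intervals
not split by an element of `S`. -/
def blockStart (S : Finset ℕ) (i : ℕ) : ℕ := Nat.findGreatest (· ∈ S) i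

theorem exists_blockEnd (S : Finset ℕ) (n i : ℕ) : ∃ m, i < m ∧ (m ∈ S ∨ n ≤ m) :=
  ⟨max n (i + 1), by omega, Or.inr (by omega)⟩

/-- The position just after the block containing `i`. -/
def blockEnd (S : Finset ℕ) (n i : ℕ) : ℕ := Nat.find (exists_blockEnd S n i)

theorem blockStart_le (S : Finset ℕ) (i : ℕ) : blockStart S i ≤ i := Nat.findGreatest_le i

theorem le_blockStart {S : Finset ℕ} {m i : ℕ} (hm : m ∈ S) (h : m ≤ i) :
    m ≤ blockStart S i := Nat.le_findGreatest h hm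

theorem blockStart_mem (S : Finset ℕ) (i : ℕ) : blockStart S i = 0 ∨ blockStart S i ∈ S := by
  by_cases h : blockStart S i = 0
  · exact Or.inl h
  · exact Or.inr (Nat.findGreatest_of_ne_zero (P := (· ∈ S)) rfl h)

theorem lt_blockEnd (S : Finset ℕ) (n i : ℕ) : i < blockEnd S n i :=
  (Nat.find_spec (exists_blockEnd S n i)).1

theorem blockEnd_mem (S : Finset ℕ) (n i : ℕ) : blockEnd S n i ∈ S ∨ n ≤ blockEnd S n i :=
  (Nat.find_spec (exists_blockEnd S n i)).2

theorem blockEnd_le {S : Finset ℕ} {n m i : ℕ} (h : i < m) (hm : m ∈ S ∨ n ≤ m) :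
    blockEnd S n i ≤ m := Nat.find_min' _ ⟨h, hm⟩

theorem blockStart_eq {S : Finset ℕ} {n i j : ℕ} (h₁ : blockStart S i ≤ j)
    (h₂ : j < blockEnd S n i) : blockStart S j = blockStart S i := by
  apply le_antisymm
  · rcases blockStart_mem S j with h | h
    · omega
    · apply le_blockStart h
      by_contra! hlt
      have := blockEnd_le (n := n) hlt (Or.inl h)
      have := blockStart_le S j
      omega
  · rcases blockStart_mem S i with h | h
    · omega
    · exact le_blockStart h h₁

theorem blockEnd_eq {S : Finset ℕ} {n i j : ℕ} (hi : i < n) (h₁ : blockStart S i ≤ j)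
    (h₂ : j < blockEnd S n i) : blockEnd S n j = blockEnd S n i := by
  apply le_antisymm (blockEnd_le h₂ (blockEnd_mem S n i))
  have hj := lt_blockEnd S n j
  apply blockEnd_le _ (blockEnd_mem S n j)
  by_contra! hle
  rcases blockEnd_mem S n j with h | h
  · have := le_blockStart h hle
    omega
  · omega

/-- Reflection of `i` inside its block. -/
def blockReflect (S : Finset ℕ) (n i : ℕ) : ℕ := blockStart S i + blockEnd S n i - 1 - i

theorem blockStart_le_blockReflect (S : Finset ℕ) (n i : ℕ) :
    blockStart S i ≤ blockReflect S n i := by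
  have := lt_blockEnd S n i
  unfold blockReflect
  omega

theorem blockReflect_lt_blockEnd (S : Finset ℕ) (n i : ℕ) :
    blockReflect S n i < blockEnd S n i := by
  have := lt_blockEnd S n i
  have := blockStart_le S i
  unfold blockReflect
  omega

theorem blockReflect_lt {S : Finset ℕ} {n i : ℕ} (hi : i < n) : blockReflect S n i < n :=
  (blockReflect_lt_blockEnd S n i).trans_le (blockEnd_le hi (Or.inr le_rfl))

theorem blockReflect_blockReflect {S : Finset ℕ} {n i : ℕ} (hi : i < n) :
    blockReflect S n (blockReflect S n i) = i := by
  have h₁ := blockStart_le_blockReflect S n i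
  have h₂ := blockReflect_lt_blockEnd S n i
  have h := lt_blockEnd S n i
  have h' := blockStart_le S i
  rw [blockReflect, blockStart_eq h₁ h₂, blockEnd_eq hi h₁ h₂, blockReflect]
  omega

theorem blockReflect_lt_blockReflect {S : Finset ℕ} {n i j : ℕ} (hj : j < n)
    (h : blockEnd S n i ≤ j) : blockReflect S n i < blockReflect S n j := by
  have h₁ := blockReflect_lt_blockEnd S n i
  have h₂ := blockStart_le_blockReflect S n j
  rcases blockEnd_mem S n i with hm | hm
  · have := le_blockStart hm h
    omega
  · omega

theorem blockReflect_lt_of_lt_blockEnd {S : Finset ℕ} {n i j : ℕ} (hij : i < j) (hj : j < n)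
    (h : j < blockEnd S n i) : blockReflect S n j < blockReflect S n i := by
  have h₁ := blockStart_le S i
  rw [blockReflect, blockStart_eq (h₁.trans hij.le) h,
    blockEnd_eq (hij.trans hj) (h₁.trans hij.le) h, blockReflect]
  omega

theorem mem_iff_blockReflect_lt {S : Finset ℕ} {n m : ℕ} (hm : m + 1 < n) :
    m + 1 ∈ S ↔ blockReflect S n m < blockReflect S n (m + 1) := by
  constructor
  · intro h
    exact blockReflect_lt_blockReflect hm (blockEnd_le (by omega) (Or.inl h))
  · intro h
    by_contra hS
    refine absurd h (blockReflect_lt_of_lt_blockEnd (by omega) hm ?_).le.not_gt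
    have h₁ := lt_blockEnd S n m
    have h₂ := blockEnd_mem S n m
    have h₃ : blockEnd S n m ≠ m + 1 := by
      intro he
      rw [he] at h₂
      exact h₂.elim hS (by omega)
    omega

/-- The layered permutation reversing each block cut out by `S`. -/
def layeredPerm (S : Finset ℕ) (n : ℕ) : Equiv.Perm (Fin n) :=
  Function.Involutive.toPerm (fun i => ⟨blockReflect S n i, blockReflect_lt i.2⟩)
    fun i => Fin.ext (blockReflect_blockReflect i.2)

theorem layeredPerm_apply (S : Finset ℕ) {n : ℕ} (i : Fin n) :
    (layeredPerm S n i : ℕ) = blockReflect S n i := rfl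

theorem layeredPerm_sq (S : Finset ℕ) (n : ℕ) : layeredPerm S n ^ 2 = 1 := by
  ext i
  simp [pow_two, layeredPerm_apply, blockReflect_blockReflect i.2]

theorem permAvoids_layeredPerm_p312 (S : Finset ℕ) (n : ℕ) :
    PermAvoids (layeredPerm S n) p312 := by
  rintro ⟨f, hf, h⟩
  have h₀₁ : f 0 < f 1 := hf (by decide)
  have h₁₂ : f 1 < f 2 := hf (by decide)
  have v₁₂ := (h 1 2).1 (by decide)
  have v₂₀ := (h 2 0).1 (by decide)
  rw [Fin.lt_def] at h₀₁ h₁₂ v₁₂ v₂₀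
  simp only [layeredPerm_apply] at v₁₂ v₂₀
  have hend : (f 2 : ℕ) < blockEnd S n (f 0) := by
    by_contra! hle
    have := blockReflect_lt_blockReflect (f 2).2 hle
    omega
  have hs := blockStart_le S (f 0)
  have he := blockEnd_eq (f 0).2 (hs.trans h₀₁.le) (h₁₂.trans hend)
  have := blockReflect_lt_of_lt_blockEnd h₁₂ (f 2).2 (he ▸ hend)
  omega

theorem permAvoids_one_p132 (n : ℕ) : PermAvoids (1 : Equiv.Perm (Fin n)) p132 := by
  rintro ⟨f, hf, h⟩
  exact absurd ((h 2 1).1 (by decide)) (hf (by decide)).not_gt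

theorem layeredPerm_injOn (n : ℕ) :
    Set.InjOn (layeredPerm · n) ((Finset.Ico 1 n).powerset : Set (Finset ℕ)) := by
  intro S hS T hT hST
  rw [Finset.mem_coe, Finset.mem_powerset] at hS hT
  have hr : ∀ i < n, blockReflect S n i = blockReflect T n i := fun i hi => by
    have h : layeredPerm S n ⟨i, hi⟩ = layeredPerm T n ⟨i, hi⟩ := DFunLike.congr_fun hST _
    simpa only [layeredPerm_apply] using congrArg Fin.val h
  have key : ∀ m ∈ Finset.Ico 1 n, (m ∈ S ↔ m ∈ T) := by
    intro m hm
    obtain ⟨k, rfl⟩ : ∃ k, m = k + 1 := ⟨m - 1, by simp at hm; omega⟩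
    have hk := (Finset.mem_Ico.1 hm).2
    rw [mem_iff_blockReflect_lt hk, mem_iff_blockReflect_lt hk, hr k (by omega), hr _ hk]
  ext m
  exact ⟨fun h => (key m (hS h)).1 h, fun h => (key m (hT h)).2 h⟩

theorem stmt8 (n : ℕ) (hn : 3 ≤ n) :
    2 ^ (n - 1) ≤ Nat.card {π : Equiv.Perm (Fin n) //
      PermAvoids π p312 ∧ PermAvoids (π ^ 2) p132} := by
  let F : (Finset.Ico 1 n).powerset → {π : Equiv.Perm (Fin n) //
      PermAvoids π p312 ∧ PermAvoids (π ^ 2) p132} := fun S =>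
    ⟨layeredPerm S n, permAvoids_layeredPerm_p312 S n,
      (layeredPerm_sq S n).symm ▸ permAvoids_one_p132 n⟩
  have hF : Function.Injective F := fun S T h =>
    Subtype.ext (layeredPerm_injOn n S.2 T.2 (congrArg Subtype.val h))
  have hcard : Nat.card (Finset.Ico 1 n).powerset = 2 ^ (n - 1) := by
    rw [Nat.card_eq_fintype_card, Fintype.card_coe, Finset.card_powerset, Nat.card_Ico]
  exact hcard ▸ Nat.card_le_card_of_injective F hF
end
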